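/- As γ → +∞ we have β_γ → β_{a/2} and u_γ → u_{a/2} in C¹_loc(Ω̄ \ {0}), where (β_{a/2}, u_{a/2}) is the unique pair with β_{a/2} > 0 and u_{a/2} the unique smooth radially symmetric solution of Δu = β_{a/2} u g(u) in Ω, u > 0 in Ω, u = 0 on ∂Ω, u(0) = a/2. -/

import Mathlib

open Real Set Filter MeasureTheory Topology

noncomputable section

/-- The radial Laplacian with the sign convention Δ = −div(∇·):
for a radial C² function, (Δu)(r) = −u''(r) − u'(r)/r. -/
def radLap (u : ℝ → ℝ) (r : ℝ) : ℝ := -(deriv (deriv u) r) - deriv u r / r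

/-- `GCtx a c0 g` : a > 0, c₀ > 0, g is continuous and positive on [0,∞), and
g(t) = exp(t² − at) for all t ≥ c₀ (hypotheses (G1)-(G2) of the paper). -/
def GCtx (a c0 : ℝ) (g : ℝ → ℝ) : Prop :=
  0 < a ∧ 0 < c0 ∧ ContinuousOn g (Set.Ici 0) ∧ (∀ t : ℝ, 0 ≤ t → 0 < g t) ∧
    ∀ t : ℝ, c0 ≤ t → g t = Real.exp (t ^ 2 - a * t)

/-- `IsGSol g beta gam u` : u is a smooth radial function on the closed unit disk,
positive in the open disk, vanishing on the boundary, with central value γ, solving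
Δu = β u g(u) in Ω (radially). -/
def IsGSol (g : ℝ → ℝ) (beta gam : ℝ) (u : ℝ → ℝ) : Prop :=
  ContDiffOn ℝ (⊤ : ℕ∞) u (Set.Icc 0 1) ∧
    (∀ r ∈ Set.Ioo (0:ℝ) 1, radLap u r = beta * u r * g (u r)) ∧
    (∀ r ∈ Set.Ico (0:ℝ) 1, 0 < u r) ∧ u 1 = 0 ∧ u 0 = gam

/-- Dirichlet energy ∫_Ω |∇u|² dy of a radial function, = ∫₀¹ u'(r)² 2πr dr. -/
def dirEnergy (u : ℝ → ℝ) : ℝ := ∫ r in Set.Ioo (0:ℝ) 1, (deriv u r) ^ 2 * (2 * π * r)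

/-- The explicit form `t ↦ t exp(t² - a t)` of the nonlinearity `t g(t)` for large `t`. -/
def expNonlin (a x : ℝ) : ℝ := x * Real.exp (x ^ 2 - a * x)

/-- The derivative of `log (expNonlin a x)`. -/
def logSlope (a x : ℝ) : ℝ := 2 * x - a + 1 / x

/-- First-order form of the radial equation `w'' + w'/r + f(w) = 0` with `q = -r w'/2`,
on `[0, ρ]`, with central value `γ`. -/
structure RadialSystem (f : ℝ → ℝ) (ρ γ : ℝ) (w q : ℝ → ℝ) : Prop where
  pos : 0 < ρ
  cont_w : ContinuousOn w (Icc 0 ρ)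
  cont_q : ContinuousOn q (Icc 0 ρ)
  deriv_w : ∀ r ∈ Ioo 0 ρ, HasDerivAt w (-2 * q r / r) r
  deriv_q : ∀ r ∈ Ioo 0 ρ, HasDerivAt q (r * f (w r) / 2) r
  w_zero : w 0 = γ
  q_zero : q 0 = 0

lemma le_of_hasDerivAt_nonneg {f f' : ℝ → ℝ} {a b : ℝ} (hab : a ≤ b)
    (hf : ContinuousOn f (Icc a b)) (hd : ∀ x ∈ Ioo a b, HasDerivAt f (f' x) x)
    (h0 : ∀ x ∈ Ioo a b, 0 ≤ f' x) : f a ≤ f b := by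
  have : MonotoneOn f (Icc a b) := by
    refine monotoneOn_of_deriv_nonneg (convex_Icc a b) hf ?_ ?_
    · rw [interior_Icc]
      exact fun x hx => (hd x hx).differentiableAt.differentiableWithinAt
    · rw [interior_Icc]
      intro x hx
      rw [(hd x hx).deriv]
      exact h0 x hx
  exact this (left_mem_Icc.2 hab) (right_mem_Icc.2 hab) hab

lemma le_of_hasDerivAt_nonpos {f f' : ℝ → ℝ} {a b : ℝ} (hab : a ≤ b)
    (hf : ContinuousOn f (Icc a b)) (hd : ∀ x ∈ Ioo a b, HasDerivAt f (f' x) x)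
    (h0 : ∀ x ∈ Ioo a b, f' x ≤ 0) : f b ≤ f a := by
  have := le_of_hasDerivAt_nonneg (f := fun x => -f x) (f' := fun x => -f' x) hab hf.neg
    (fun x hx => (hd x hx).neg) (fun x hx => by linarith [h0 x hx])
  linarith

lemma expNonlin_pos (a : ℝ) {x : ℝ} (hx : 0 < x) : 0 < expNonlin a x :=
  mul_pos hx (Real.exp_pos _)

lemma continuous_expNonlin (a : ℝ) : Continuous (expNonlin a) := by
  unfold expNonlin; fun_prop

lemma hasDerivAt_expNonlin (a : ℝ) {x : ℝ} (hx : x ≠ 0) :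
    HasDerivAt (expNonlin a) (logSlope a x * expNonlin a x) x := by
  have h1 : HasDerivAt (fun x : ℝ => x ^ 2 - a * x) (2 * x - a) x := by
    exact ((hasDerivAt_pow 2 x).sub ((hasDerivAt_id x).const_mul a)).congr_deriv (by simp)
  have h2 := (hasDerivAt_id x).mul h1.exp
  refine h2.congr_deriv ?_
  simp only [logSlope, expNonlin, id]
  field_simp
  ring

lemma expNonlin_mono {a x y : ℝ} (hx : 0 < x) (hax : a ≤ x) (hxy : x ≤ y) :
    expNonlin a x ≤ expNonlin a y := by
  unfold expNonlin
  gcongr ?_ * Real.exp ?_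
  · linarith
  · nlinarith

lemma logSlope_mono {a x y : ℝ} (hx : 1 ≤ x) (hxy : x ≤ y) : logSlope a x ≤ logSlope a y := by
  unfold logSlope
  have : 1 / x - 1 / y ≤ y - x := by
    rw [div_sub_div _ _ (by linarith) (by linarith), div_le_iff₀ (by nlinarith)]
    nlinarith [mul_nonneg (sub_nonneg.2 hxy) (by nlinarith : (0:ℝ) ≤ x * y - 1)]
  linarith

lemma logSlope_pos {a x : ℝ} (hx : 1 ≤ x) (hax : a ≤ x) : 0 < logSlope a x := by
  unfold logSlope
  have : 0 < 1 / x := by positivity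
  linarith

lemma hasDerivAt_logSlope (a : ℝ) {x : ℝ} (hx : x ≠ 0) :
    HasDerivAt (logSlope a) (2 - 1 / x ^ 2) x := by
  have h := (((hasDerivAt_id x).const_mul 2).sub_const a).add ((hasDerivAt_id x).inv hx)
  have h' : HasDerivAt (fun x : ℝ => 2 * x - a + x⁻¹) (2 * 1 + -1 / x ^ 2) x := h
  have e : logSlope a = fun x : ℝ => 2 * x - a + x⁻¹ := by
    funext y; simp [logSlope]
  rw [e]
  refine h'.congr_deriv ?_
  ring

namespace RadialSystem

variable {f : ℝ → ℝ} {ρ γ : ℝ} {w q : ℝ → ℝ}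

lemma restrict (h : RadialSystem f ρ γ w q) {σ : ℝ} (hσ : 0 < σ) (hσρ : σ ≤ ρ) :
    RadialSystem f σ γ w q where
  pos := hσ
  cont_w := h.cont_w.mono (Icc_subset_Icc_right hσρ)
  cont_q := h.cont_q.mono (Icc_subset_Icc_right hσρ)
  deriv_w r hr := h.deriv_w r ⟨hr.1, hr.2.trans_le hσρ⟩
  deriv_q r hr := h.deriv_q r ⟨hr.1, hr.2.trans_le hσρ⟩
  w_zero := h.w_zero
  q_zero := h.q_zero

lemma congr {f₁ : ℝ → ℝ} (h : RadialSystem f ρ γ w q) (hf : ∀ r ∈ Ioo 0 ρ, f (w r) = f₁ (w r)) :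
    RadialSystem f₁ ρ γ w q :=
  { h with deriv_q := fun r hr => hf r hr ▸ h.deriv_q r hr }

lemma q_mono (h : RadialSystem f ρ γ w q) (hf : ∀ r ∈ Ioo 0 ρ, 0 ≤ f (w r)) {x y : ℝ}
    (hx : 0 ≤ x) (hxy : x ≤ y) (hy : y ≤ ρ) : q x ≤ q y := by
  refine le_of_hasDerivAt_nonneg (f' := fun r => r * f (w r) / 2) hxy
    (h.cont_q.mono (Icc_subset_Icc hx hy)) (fun r hr => ?_) (fun r hr => ?_)
  · exact h.deriv_q r ⟨hx.trans_lt hr.1, hr.2.trans_le hy⟩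
  · have := hf r ⟨hx.trans_lt hr.1, hr.2.trans_le hy⟩
    have : 0 < r := hx.trans_lt hr.1
    positivity

lemma q_nonneg (h : RadialSystem f ρ γ w q) (hf : ∀ r ∈ Ioo 0 ρ, 0 ≤ f (w r)) {x : ℝ}
    (hx : 0 ≤ x) (hxρ : x ≤ ρ) : 0 ≤ q x :=
  h.q_zero ▸ h.q_mono hf le_rfl hx hxρ

lemma w_anti (h : RadialSystem f ρ γ w q) (hf : ∀ r ∈ Ioo 0 ρ, 0 ≤ f (w r)) {x y : ℝ}
    (hx : 0 ≤ x) (hxy : x ≤ y) (hy : y ≤ ρ) : w y ≤ w x := by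
  refine le_of_hasDerivAt_nonpos (f' := fun r => -2 * q r / r) hxy
    (h.cont_w.mono (Icc_subset_Icc hx hy)) (fun r hr => ?_) (fun r hr => ?_)
  · exact h.deriv_w r ⟨hx.trans_lt hr.1, hr.2.trans_le hy⟩
  · have h0 : 0 < r := hx.trans_lt hr.1
    have := h.q_nonneg hf h0.le (hr.2.le.trans hy)
    exact div_nonpos_of_nonpos_of_nonneg (by linarith) h0.le

lemma w_le (h : RadialSystem f ρ γ w q) (hf : ∀ r ∈ Ioo 0 ρ, 0 ≤ f (w r)) {x : ℝ}
    (hx : 0 ≤ x) (hxρ : x ≤ ρ) : w x ≤ γ :=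
  h.w_zero ▸ h.w_anti hf le_rfl hx hxρ

/-- If `q ≤ Q` on `[x, y]`, then `w` decreases at most logarithmically with slope `2Q`. -/
lemma w_ge_of_q_le (h : RadialSystem f ρ γ w q) {x y Q : ℝ} (hx : 0 < x) (hxy : x ≤ y)
    (hy : y ≤ ρ) (hQ : ∀ r ∈ Ioo x y, q r ≤ Q) :
    w x - 2 * Q * (Real.log y - Real.log x) ≤ w y := by
  have := le_of_hasDerivAt_nonneg (f := fun r => w r + 2 * Q * Real.log r)
    (f' := fun r => -2 * q r / r + 2 * Q * r⁻¹) hxy ?_ ?_ ?_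
  · linarith
  · refine (h.cont_w.mono (Icc_subset_Icc hx.le hy)).add (continuousOn_const.mul ?_)
    exact Real.continuousOn_log.mono fun r hr => (hx.trans_le hr.1).ne'
  · intro r hr
    have h0 : 0 < r := hx.trans hr.1
    exact (h.deriv_w r ⟨h0, hr.2.trans_le hy⟩).add ((Real.hasDerivAt_log h0.ne').const_mul _)
  · intro r hr
    have h0 : 0 < r := hx.trans hr.1
    have : -2 * q r / r + 2 * Q * r⁻¹ = 2 * (Q - q r) / r := by field_simp; ring
    rw [this]
    have := hQ r hr
    exact div_nonneg (by linarith) h0.le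

/-- If `Q ≤ q` on `[x, y]`, then `w` decreases at least logarithmically with slope `2Q`. -/
lemma w_le_of_le_q (h : RadialSystem f ρ γ w q) {x y Q : ℝ} (hx : 0 < x) (hxy : x ≤ y)
    (hy : y ≤ ρ) (hQ : ∀ r ∈ Ioo x y, Q ≤ q r) :
    w y ≤ w x - 2 * Q * (Real.log y - Real.log x) := by
  have := le_of_hasDerivAt_nonpos (f := fun r => w r + 2 * Q * Real.log r)
    (f' := fun r => -2 * q r / r + 2 * Q * r⁻¹) hxy ?_ ?_ ?_
  · linarith
  · refine (h.cont_w.mono (Icc_subset_Icc hx.le hy)).add (continuousOn_const.mul ?_)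
    exact Real.continuousOn_log.mono fun r hr => (hx.trans_le hr.1).ne'
  · intro r hr
    have h0 : 0 < r := hx.trans hr.1
    exact (h.deriv_w r ⟨h0, hr.2.trans_le hy⟩).add ((Real.hasDerivAt_log h0.ne').const_mul _)
  · intro r hr
    have h0 : 0 < r := hx.trans hr.1
    have : -2 * q r / r + 2 * Q * r⁻¹ = 2 * (Q - q r) / r := by field_simp; ring
    rw [this]
    have := hQ r hr
    exact div_nonpos_of_nonpos_of_nonneg (by linarith) h0.le

/-- A bound on the nonlinearity controls the growth of `q`. -/
lemma q_le_of_f_le (h : RadialSystem f ρ γ w q) {x y M : ℝ} (hx : 0 ≤ x) (hxy : x ≤ y)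
    (hy : y ≤ ρ) (hM : ∀ r ∈ Ioo x y, f (w r) ≤ M) :
    q y ≤ q x + M * (y ^ 2 - x ^ 2) / 4 := by
  have := le_of_hasDerivAt_nonpos (f := fun r => q r - M / 4 * r ^ 2)
    (f' := fun r => r * f (w r) / 2 - M / 4 * (2 * r)) hxy ?_ ?_ ?_
  · linarith
  · exact (h.cont_q.mono (Icc_subset_Icc hx hy)).sub (by fun_prop)
  · intro r hr
    refine (h.deriv_q r ⟨hx.trans_lt hr.1, hr.2.trans_le hy⟩).sub ?_
    simpa using (hasDerivAt_pow 2 r).const_mul (M / 4)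
  · intro r hr
    nlinarith [hM r hr, hx.trans_lt hr.1]

lemma q_ge_of_le_f (h : RadialSystem f ρ γ w q) {x y M : ℝ} (hx : 0 ≤ x) (hxy : x ≤ y)
    (hy : y ≤ ρ) (hM : ∀ r ∈ Ioo x y, M ≤ f (w r)) :
    q x + M * (y ^ 2 - x ^ 2) / 4 ≤ q y := by
  have := le_of_hasDerivAt_nonneg (f := fun r => q r - M / 4 * r ^ 2)
    (f' := fun r => r * f (w r) / 2 - M / 4 * (2 * r)) hxy ?_ ?_ ?_
  · linarith
  · exact (h.cont_q.mono (Icc_subset_Icc hx hy)).sub (by fun_prop)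
  · intro r hr
    refine (h.deriv_q r ⟨hx.trans_lt hr.1, hr.2.trans_le hy⟩).sub ?_
    simpa using (hasDerivAt_pow 2 r).const_mul (M / 4)
  · intro r hr
    nlinarith [hM r hr, hx.trans_lt hr.1]

lemma w_ge_of_f_le (h : RadialSystem f ρ γ w q) {x M : ℝ} (hx : 0 ≤ x) (hxρ : x ≤ ρ)
    (hM : ∀ r ∈ Ioo 0 ρ, f (w r) ≤ M) : γ - M * x ^ 2 / 4 ≤ w x := by
  have := le_of_hasDerivAt_nonneg (f := fun r => w r + M / 4 * r ^ 2)
    (f' := fun r => -2 * q r / r + M / 4 * (2 * r)) hx ?_ ?_ ?_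
  · simp only [h.w_zero] at this; linarith
  · exact (h.cont_w.mono (Icc_subset_Icc le_rfl hxρ)).add (by fun_prop)
  · intro r hr
    refine (h.deriv_w r ⟨hr.1, hr.2.trans_le hxρ⟩).add ?_
    simpa using (hasDerivAt_pow 2 r).const_mul (M / 4)
  · intro r hr
    have h0 := hr.1
    have h1 := h.q_le_of_f_le le_rfl hr.1.le (hr.2.le.trans hxρ)
      (fun s hs => hM s ⟨hs.1, hs.2.trans (hr.2.trans_le hxρ)⟩)
    rw [h.q_zero] at h1
    have : -2 * q r / r + M / 4 * (2 * r) = 2 * (M * r ^ 2 / 4 - q r) / r := by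
      field_simp; ring
    rw [this]
    exact div_nonneg (by linarith) h0.le

end RadialSystem

namespace RadialSystem

variable {a ρ γ : ℝ} {w q : ℝ → ℝ}

lemma hasDerivAt_energy (h : RadialSystem (expNonlin a) ρ γ w q) {r : ℝ} (hr : r ∈ Ioo 0 ρ)
    (hw : w r ≠ 0) :
    HasDerivAt (fun r => r ^ 2 * expNonlin a (w r) / 4)
      (r * expNonlin a (w r) / 2 * (1 - logSlope a (w r) * q r)) r := by
  have h1 := (hasDerivAt_expNonlin a hw).comp r (h.deriv_w r hr)
  have h2 := ((hasDerivAt_pow 2 r).mul h1).div_const 4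
  refine h2.congr_deriv ?_
  have : r ≠ 0 := hr.1.ne'
  simp only [Function.comp]
  field_simp
  ring

lemma continuousOn_energy (h : RadialSystem (expNonlin a) ρ γ w q) :
    ContinuousOn (fun r => r ^ 2 * expNonlin a (w r) / 4) (Icc 0 ρ) :=
  ((continuousOn_pow 2).mul ((continuous_expNonlin a).comp_continuousOn h.cont_w)).div_const 4

/-- A Pohozaev-type inequality, coming from the convexity of `log (expNonlin a)`. -/
lemma energy_le (h : RadialSystem (expNonlin a) ρ γ w q) (hw : ∀ r ∈ Icc 0 ρ, 1 ≤ w r)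
    {r : ℝ} (hr : r ∈ Icc 0 ρ) :
    logSlope a (w r) * q r ^ 2 / 2 + r ^ 2 * expNonlin a (w r) / 4 ≤ q r := by
  have hf : ∀ r ∈ Ioo 0 ρ, 0 ≤ expNonlin a (w r) := fun r hr =>
    (expNonlin_pos a (by linarith [hw r (Ioo_subset_Icc_self hr)])).le
  have hsub : Icc 0 r ⊆ Icc 0 ρ := Icc_subset_Icc le_rfl hr.2
  have key := le_of_hasDerivAt_nonneg
    (f := fun s => q s - logSlope a (w s) * q s ^ 2 / 2 - s ^ 2 * expNonlin a (w s) / 4)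
    (f' := fun s => (2 - 1 / w s ^ 2) * q s ^ 3 / s) hr.1 ?_ ?_ ?_
  · simp only [h.q_zero] at key
    linarith
  · have hl : ContinuousOn (fun s => logSlope a (w s)) (Icc 0 r) := by
      unfold logSlope
      have hc := h.cont_w.mono hsub
      refine ((continuousOn_const.mul hc).sub continuousOn_const).add
        (continuousOn_const.div hc fun s hs => ?_)
      linarith [hw s (hsub hs)]
    have hq := h.cont_q.mono hsub
    exact (hq.sub ((hl.mul (hq.pow 2)).div_const 2)).sub (h.continuousOn_energy.mono hsub)
  · intro s hs
    have hs' : s ∈ Ioo 0 ρ := ⟨hs.1, hs.2.trans_le hr.2⟩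
    have hws : w s ≠ 0 := by linarith [hw s (Ioo_subset_Icc_self hs')]
    have h1 := (hasDerivAt_logSlope a hws).comp s (h.deriv_w s hs')
    have h2 := ((h.deriv_q s hs').sub ((h1.mul ((h.deriv_q s hs').pow 2)).div_const 2)).sub
      (h.hasDerivAt_energy hs' hws)
    refine h2.congr_deriv ?_
    have : s ≠ 0 := hs.1.ne'
    simp only [Function.comp, Pi.pow_apply]
    push_cast
    field_simp
    ring
  · intro s hs
    have hs' : s ∈ Icc 0 ρ := ⟨hs.1.le, hs.2.le.trans hr.2⟩
    have hq := h.q_nonneg hf hs'.1 hs'.2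
    have h1 : 1 / w s ^ 2 ≤ 1 := by
      rw [div_le_one (by nlinarith [hw s hs'])]
      nlinarith [hw s hs']
    have := hs.1
    have : 0 ≤ 2 - 1 / w s ^ 2 := by linarith
    positivity

/-- Comparison with the bubble obtained by linearizing `log (expNonlin a)` at `γ`. -/
lemma energy_ge (h : RadialSystem (expNonlin a) ρ γ w q) (hw : ∀ r ∈ Icc 0 ρ, 1 ≤ w r)
    {r : ℝ} (hr : r ∈ Icc 0 ρ) :
    q r - logSlope a γ * q r ^ 2 / 2 ≤ r ^ 2 * expNonlin a (w r) / 4 := by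
  have hf : ∀ r ∈ Ioo 0 ρ, 0 ≤ expNonlin a (w r) := fun r hr =>
    (expNonlin_pos a (by linarith [hw r (Ioo_subset_Icc_self hr)])).le
  have hsub : Icc 0 r ⊆ Icc 0 ρ := Icc_subset_Icc le_rfl hr.2
  have key := le_of_hasDerivAt_nonneg
    (f := fun s => s ^ 2 * expNonlin a (w s) / 4 - (q s - logSlope a γ * q s ^ 2 / 2))
    (f' := fun s => s * expNonlin a (w s) / 2 * q s * (logSlope a γ - logSlope a (w s)))
    hr.1 ?_ ?_ ?_
  · simp only [h.q_zero] at key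
    linarith
  · have hq := h.cont_q.mono hsub
    exact (h.continuousOn_energy.mono hsub).sub
      (hq.sub ((continuousOn_const.mul (hq.pow 2)).div_const 2))
  · intro s hs
    have hs' : s ∈ Ioo 0 ρ := ⟨hs.1, hs.2.trans_le hr.2⟩
    have hws : w s ≠ 0 := by linarith [hw s (Ioo_subset_Icc_self hs')]
    have h2 := (h.hasDerivAt_energy hs' hws).sub ((h.deriv_q s hs').sub
      ((((h.deriv_q s hs').pow 2).const_mul (logSlope a γ)).div_const 2))
    refine h2.congr_deriv ?_
    push_cast
    ring
  · intro s hs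
    have hs' : s ∈ Icc 0 ρ := ⟨hs.1.le, hs.2.le.trans hr.2⟩
    have hq := h.q_nonneg hf hs'.1 hs'.2
    have h1 := logSlope_mono (a := a) (hw s hs') (h.w_le hf hs'.1 hs'.2)
    have h2 := expNonlin_pos a (by linarith [hw s hs'] : 0 < w s)
    have h3 : 0 ≤ logSlope a γ - logSlope a (w s) := by linarith
    have := hs.1
    positivity

lemma q_pos (h : RadialSystem (expNonlin a) ρ γ w q)
    (hw : ∀ r ∈ Icc 0 ρ, 1 ≤ w r ∧ a ≤ w r) {r : ℝ} (hr : r ∈ Ioc 0 ρ) : 0 < q r := by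
  have hf : ∀ r ∈ Ioo 0 ρ, 0 ≤ expNonlin a (w r) := fun r hr =>
    (expNonlin_pos a (by linarith [(hw r (Ioo_subset_Icc_self hr)).1])).le
  have hwr := hw r (Ioc_subset_Icc_self hr)
  have hp : 0 < expNonlin a (w r) := expNonlin_pos a (by linarith)
  have := h.q_ge_of_le_f le_rfl hr.1.le hr.2 (M := expNonlin a (w r)) fun s hs =>
    expNonlin_mono (by linarith) hwr.2 (h.w_anti hf hs.1.le hs.2.le hr.2)
  rw [h.q_zero] at this
  have h0 := hr.1
  have : 0 < expNonlin a (w r) * (r ^ 2 - 0 ^ 2) / 4 := by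
    simp only [ne_eq, OfNat.ofNat_ne_zero, not_false_eq_true, zero_pow, sub_zero]; positivity
  linarith

lemma logSlope_mul_q_le (h : RadialSystem (expNonlin a) ρ γ w q)
    (hw : ∀ r ∈ Icc 0 ρ, 1 ≤ w r ∧ a ≤ w r) {r : ℝ} (hr : r ∈ Ioc 0 ρ) :
    logSlope a (w r) * q r ≤ 2 := by
  have h1 := h.energy_le (fun r hr => (hw r hr).1) (Ioc_subset_Icc_self hr)
  have h2 := h.q_pos hw hr
  have h3 : 0 ≤ r ^ 2 * expNonlin a (w r) / 4 := by
    have := expNonlin_pos a (by linarith [(hw r (Ioc_subset_Icc_self hr)).1] : 0 < w r)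
    positivity
  by_contra! h4
  nlinarith

/-- The quantity `r⁴ f(w)` is nondecreasing. -/
lemma pow_four_mul_mono (h : RadialSystem (expNonlin a) ρ γ w q)
    (hw : ∀ r ∈ Icc 0 ρ, 1 ≤ w r ∧ a ≤ w r) {x y : ℝ} (hx : 0 ≤ x) (hxy : x ≤ y) (hy : y ≤ ρ) :
    x ^ 4 * expNonlin a (w x) ≤ y ^ 4 * expNonlin a (w y) := by
  refine le_of_hasDerivAt_nonneg (f := fun r => r ^ 4 * expNonlin a (w r))
    (f' := fun r => r ^ 3 * expNonlin a (w r) * (2 * (2 - logSlope a (w r) * q r))) hxy ?_ ?_ ?_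
  · exact (continuousOn_pow 4).mul ((continuous_expNonlin a).comp_continuousOn
      (h.cont_w.mono (Icc_subset_Icc hx hy)))
  · intro r hr
    have hr' : r ∈ Ioo 0 ρ := ⟨hx.trans_lt hr.1, hr.2.trans_le hy⟩
    have hwr : w r ≠ 0 := by linarith [(hw r (Ioo_subset_Icc_self hr')).1]
    have h1 := (hasDerivAt_pow 4 r).mul
      ((hasDerivAt_expNonlin a hwr).comp r (h.deriv_w r hr'))
    refine h1.congr_deriv ?_
    have : r ≠ 0 := hr'.1.ne'
    simp only [Function.comp]
    push_cast
    field_simp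
    ring
  · intro r hr
    have hr' : r ∈ Ioc 0 ρ := ⟨hx.trans_lt hr.1, hr.2.le.trans hy⟩
    have h1 := h.logSlope_mul_q_le hw hr'
    have h2 := expNonlin_pos a (by linarith [(hw r (Ioc_subset_Icc_self hr')).1] : 0 < w r)
    have h3 := hr'.1
    have h4 : 0 ≤ 2 - logSlope a (w r) * q r := by linarith
    positivity

/-- Lower bound on the mass, by comparison with the bubble at height `γ`. -/
lemma inv_q_le (h : RadialSystem (expNonlin a) ρ γ w q)
    (hw : ∀ r ∈ Icc 0 ρ, 1 ≤ w r ∧ a ≤ w r) {r : ℝ} (hr : r ∈ Ioc 0 ρ) :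
    1 / q r ≤ logSlope a γ / 2 + 8 / (expNonlin a γ * r ^ 2) := by
  have hγ1 : 1 ≤ γ := h.w_zero ▸ (hw 0 ⟨le_rfl, h.pos.le⟩).1
  have ha : a ≤ γ := h.w_zero ▸ (hw 0 ⟨le_rfl, h.pos.le⟩).2
  have hFγ := expNonlin_pos a (by linarith : 0 < γ)
  have hf : ∀ r ∈ Ioo 0 ρ, 0 ≤ expNonlin a (w r) := fun r hr =>
    (expNonlin_pos a (by linarith [(hw r (Ioo_subset_Icc_self hr)).1])).le
  have hk := logSlope_pos hγ1 ha
  obtain ⟨s, hs0, hsr, hs⟩ : ∃ s, 0 < s ∧ s < r ∧ ∀ x ∈ Ioo 0 s,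
      expNonlin a γ / 2 ≤ expNonlin a (w x) := by
    have hc : ContinuousWithinAt (fun x => expNonlin a (w x)) (Icc 0 ρ) 0 :=
      ((continuous_expNonlin a).comp_continuousOn h.cont_w) 0 ⟨le_rfl, h.pos.le⟩
    have hlt : expNonlin a γ / 2 < expNonlin a (w 0) := by rw [h.w_zero]; linarith
    have hev := hc.eventually (lt_mem_nhds hlt)
    obtain ⟨ε, hε, hball⟩ := Metric.mem_nhdsWithin_iff.1 hev
    refine ⟨min (ε / 2) (r / 2), by have := hr.1; positivity, ?_, fun x hx => ?_⟩
    · exact (min_le_right _ _).trans_lt (by linarith [hr.1])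
    · have h1 : x < ε / 2 := hx.2.trans_le (min_le_left _ _)
      have h2 : x < r / 2 := hx.2.trans_le (min_le_right _ _)
      refine (hball ⟨?_, hx.1.le, by linarith [hr.2, hr.1]⟩ : _ < _).le
      rw [Metric.mem_ball, Real.dist_eq, sub_zero, abs_of_pos hx.1]
      linarith
  have hqs := h.q_ge_of_le_f le_rfl hs0.le (hsr.le.trans hr.2) hs
  rw [h.q_zero] at hqs
  have key := le_of_hasDerivAt_nonpos
    (f := fun x => x ^ 2 * (1 / q x - logSlope a γ / 2))
    (f' := fun x => 2 * x / q x ^ 2 *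
      (q x - logSlope a γ * q x ^ 2 / 2 - x ^ 2 * expNonlin a (w x) / 4)) hsr.le ?_ ?_ ?_
  · have h1 : s ^ 2 * (1 / q s - logSlope a γ / 2) ≤ 8 / expNonlin a γ := by
      have hq : expNonlin a γ * s ^ 2 / 8 ≤ q s := by linarith
      have hq0 : 0 < q s := lt_of_lt_of_le (by positivity) hq
      have : s ^ 2 * (1 / q s) ≤ 8 / expNonlin a γ := by
        rw [mul_one_div, div_le_div_iff₀ hq0 hFγ]; linarith
      nlinarith [sq_nonneg s]
    have h2 : r ^ 2 * (1 / q r - logSlope a γ / 2) ≤ 8 / expNonlin a γ := key.trans h1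
    have h3 : 0 < r ^ 2 := by have := hr.1; positivity
    have h4 : 1 / q r - logSlope a γ / 2 ≤ 8 / expNonlin a γ / r ^ 2 := by
      rw [le_div_iff₀ h3]; linarith
    rw [div_div] at h4
    linarith
  · refine (continuousOn_pow 2).mul ((continuousOn_const.div
      (h.cont_q.mono (Icc_subset_Icc hs0.le hr.2)) fun x hx => ?_).sub continuousOn_const)
    exact (h.q_pos hw ⟨hs0.trans_le hx.1, hx.2.trans hr.2⟩).ne'
  · intro x hx
    have hx' : x ∈ Ioo 0 ρ := ⟨hs0.trans hx.1, hx.2.trans_le hr.2⟩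
    have hq := h.q_pos hw (Ioo_subset_Ioc_self hx')
    have h1 := (hasDerivAt_pow 2 x).mul
      (((h.deriv_q x hx').inv hq.ne').sub_const (logSlope a γ / 2))
    have e : (fun x => x ^ 2 * (1 / q x - logSlope a γ / 2)) =
        (fun x => x ^ 2 * ((q x)⁻¹ - logSlope a γ / 2)) := by simp only [one_div]
    rw [e]
    refine h1.congr_deriv ?_
    simp only [Pi.inv_apply]
    push_cast
    field_simp
    ring
  · intro x hx
    have hx' : x ∈ Ioo 0 ρ := ⟨hs0.trans hx.1, hx.2.trans_le hr.2⟩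
    have hq := h.q_pos hw (Ioo_subset_Ioc_self hx')
    have h1 := h.energy_ge (fun r hr => (hw r hr).1) (Ioo_subset_Icc_self hx')
    have h2 := hx'.1
    exact mul_nonpos_of_nonneg_of_nonpos (by positivity) (by linarith)

end RadialSystem

lemma log_expNonlin (a : ℝ) {x : ℝ} (hx : 0 < x) :
    Real.log (expNonlin a x) = Real.log x + (x ^ 2 - a * x) := by
  rw [expNonlin, Real.log_mul hx.ne' (Real.exp_pos _).ne', Real.log_exp]

/-- Twice this quantity is `-log` of the squared radius `16 e^{√γ} / (k f(γ))`, `k = logSlope a γ`,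
at which the bubble of height `γ` has been left. -/
def exitLevel (a γ : ℝ) : ℝ :=
  (Real.log (expNonlin a γ) + Real.log (logSlope a γ / 16) - √γ) / 2

/-- Lower bound for `2q` after the bubble. -/
def slopeLower (a γ : ℝ) : ℝ := 4 / (logSlope a γ * (1 + Real.exp (-√γ)))

/-- Upper bound for `q` after the bubble and before `w` becomes bounded. -/
def massUpper (a γ : ℝ) : ℝ :=
  2 / (logSlope a γ - 14 / √γ) + Real.exp (-√γ / 2) * (exitLevel a γ - √γ)

/-- Largeness requirement on `γ` in terms of `a` and the threshold `c`. -/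
structure IsLarge (a c γ : ℝ) : Prop where
  one_le : 1 ≤ c
  le_c : a / 2 + 2 ≤ c
  a_le : a ≤ c
  a_pos : 0 < a
  sqrt_ge : 100 * c ≤ √γ
  exit_ge : √γ ≤ exitLevel a γ
  line_lt : γ - slopeLower a γ * exitLevel a γ < c

namespace IsLarge

variable {a c γ : ℝ}

lemma hundred_le (h : IsLarge a c γ) : 100 ≤ √γ := by linarith [h.sqrt_ge, h.one_le]

lemma sq_sqrt (h : IsLarge a c γ) : √γ ^ 2 = γ := by
  refine Real.sq_sqrt ?_
  by_contra! hneg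
  have := h.hundred_le
  rw [Real.sqrt_eq_zero_of_nonpos hneg.le] at this
  linarith

lemma mul_c_le (h : IsLarge a c γ) : 10000 * c ≤ γ := by
  nlinarith [h.sq_sqrt, h.hundred_le, h.sqrt_ge, h.one_le]

lemma gamma_pos (h : IsLarge a c γ) : 0 < γ := by linarith [h.mul_c_le, h.one_le]

lemma inv_le (h : IsLarge a c γ) : 1 / γ ≤ 1 / 100 := by
  apply one_div_le_one_div_of_le (by norm_num)
  linarith [h.mul_c_le, h.one_le]

lemma le_logSlope (h : IsLarge a c γ) : 2 * γ - a ≤ logSlope a γ := by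
  unfold logSlope
  have := one_div_pos.2 h.gamma_pos
  linarith

lemma gamma_le_logSlope (h : IsLarge a c γ) : γ ≤ logSlope a γ := by
  linarith [h.le_logSlope, h.mul_c_le, h.a_le, h.one_le]

lemma logSlope_le (h : IsLarge a c γ) : logSlope a γ ≤ 2 * γ + 1 := by
  unfold logSlope
  linarith [h.inv_le, h.a_pos]

lemma exp_neg_le (h : IsLarge a c γ) : γ * Real.exp (-√γ) ≤ 6 / 100 := by
  have h1 := Real.pow_div_factorial_le_exp (√γ) (Real.sqrt_nonneg _) 3
  have h2 : γ * √γ = √γ ^ 3 := by rw [pow_succ, h.sq_sqrt]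
  simp only [Nat.factorial] at h1
  norm_num at h1
  rw [Real.exp_neg, ← div_eq_mul_inv, div_le_iff₀ (Real.exp_pos _)]
  nlinarith [h.hundred_le, h.gamma_pos]

lemma exp_two_exitLevel (h : IsLarge a c γ) :
    Real.exp (-exitLevel a γ) ^ 2 * (logSlope a γ * expNonlin a γ) = 16 * Real.exp (√γ) := by
  have hk : 0 < logSlope a γ := h.gamma_pos.trans_le h.gamma_le_logSlope
  have hF := expNonlin_pos a h.gamma_pos
  rw [← Real.exp_nat_mul]
  have : ((2 : ℕ) : ℝ) * -exitLevel a γ =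
      √γ - Real.log (expNonlin a γ) - Real.log (logSlope a γ / 16) := by
    unfold exitLevel; push_cast; ring
  rw [this, Real.exp_sub, Real.exp_sub, Real.exp_log hF, Real.exp_log (by positivity)]
  field_simp

lemma slopeLower_pos (h : IsLarge a c γ) : 0 < slopeLower a γ := by
  have hk : 0 < logSlope a γ := h.gamma_pos.trans_le h.gamma_le_logSlope
  unfold slopeLower; positivity

/-- The numerical inequality behind the exponential smallness of `r² f(w)` between the bubble and
the region where `w` is bounded. -/
lemma exponent_le (h : IsLarge a c γ) {x : ℝ} (hcx : c ≤ x) (hx : x ≤ γ - slopeLower a γ * √γ) :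
    (γ - x) * (2 / slopeLower a γ + a - γ - x) + √γ - Real.log (logSlope a γ / 16) ≤ -√γ / 2 := by
  have hk : 0 < logSlope a γ := h.gamma_pos.trans_le h.gamma_le_logSlope
  have hS := h.hundred_le
  have hs := h.slopeLower_pos
  have hlog : 0 ≤ Real.log (logSlope a γ / 16) := by
    apply Real.log_nonneg
    linarith [h.gamma_le_logSlope, h.mul_c_le, h.one_le]
  have hE := h.exp_neg_le
  have hE0 := Real.exp_pos (-√γ)
  have hE1 : Real.exp (-√γ) ≤ 1 / 100 := by
    have : 100 ≤ γ := by linarith [h.mul_c_le, h.one_le]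
    nlinarith
  have h1 : 2 / slopeLower a γ ≤ γ - a / 2 + 1 / 10 := by
    have : 2 / slopeLower a γ = logSlope a γ / 2 + logSlope a γ / 2 * Real.exp (-√γ) := by
      unfold slopeLower; field_simp; ring
    rw [this]
    have h2 : logSlope a γ / 2 = γ - a / 2 + 1 / γ / 2 := by unfold logSlope; ring
    have h3 : logSlope a γ / 2 * Real.exp (-√γ) ≤ γ * Real.exp (-√γ) + Real.exp (-√γ) := by
      nlinarith [h.logSlope_le]
    linarith [h.inv_le]
  have h0 : 1.8 / √γ ≤ slopeLower a γ * √γ := by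
    have h2 : 1.8 / γ ≤ slopeLower a γ := by
      unfold slopeLower
      rw [div_le_div_iff₀ h.gamma_pos (by positivity)]
      nlinarith [h.logSlope_le, h.mul_c_le, h.one_le]
    calc 1.8 / √γ = 1.8 / γ * √γ := by
          nth_rw 2 [← h.sq_sqrt]
          field_simp
      _ ≤ _ := by gcongr
  have hy0 : 1.8 / √γ ≤ γ - x := by linarith
  have hpos : 0 < 1.8 / √γ := by positivity
  have hsm : 1.8 / √γ ≤ 1 := by rw [div_le_one (by linarith)]; linarith
  have hSS : 1.8 / √γ * γ = 1.8 * √γ := by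
    nth_rw 2 [← h.sq_sqrt]
    field_simp
  have hγ : 10000 * c ≤ γ := h.mul_c_le
  have hγS : 100 * √γ ≤ γ := by nlinarith [h.sq_sqrt]
  have key : 1.5 * √γ ≤ (γ - x) * (x - a / 2 - 1 / 10) := by
    have hcc : c - a / 2 - 1 / 10 ≥ 1.5 := by linarith [h.le_c]
    have hγc : γ - c ≥ 1.8 / √γ := by linarith
    by_cases hx2 : x ≤ γ / 2
    · nlinarith
    · have : (x - a / 2 - 1 / 10) ≥ γ / 2 * 0.99 := by linarith [h.a_le, h.one_le]
      by_cases hx3 : γ - x ≤ 4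
      · have : (x - a / 2 - 1 / 10) ≥ 0.99 * γ := by linarith [h.a_le, h.one_le]
        nlinarith
      · nlinarith
  nlinarith [mul_le_mul_of_nonneg_left h1 (hpos.le.trans hy0)]

end IsLarge

namespace RadialSystem

variable {a c ρ γ : ℝ} {w q : ℝ → ℝ}

/-- Up to the radius `exp (√γ - exitLevel)`, `w` stays close to `γ`. -/
lemma w_ge_of_le_exit (h : RadialSystem (expNonlin a) ρ γ w q) (hL : IsLarge a c γ)
    (hw : ∀ r ∈ Icc 0 ρ, c ≤ w r) (hρ : ρ ≤ Real.exp (-(exitLevel a γ - √γ))) :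
    γ - 7 / √γ ≤ w ρ := by
  have hk : 0 < logSlope a γ := hL.gamma_pos.trans_le hL.gamma_le_logSlope
  have hF := expNonlin_pos a hL.gamma_pos
  have hS := hL.hundred_le
  have hγ := hL.gamma_pos
  have hw' : ∀ r ∈ Icc 0 ρ, 1 ≤ w r ∧ a ≤ w r := fun r hr =>
    ⟨hL.one_le.trans (hw r hr), hL.a_le.trans (hw r hr)⟩
  have hf : ∀ r ∈ Ioo 0 ρ, 0 ≤ expNonlin a (w r) := fun r hr =>
    (expNonlin_pos a (by linarith [(hw' r (Ioo_subset_Icc_self hr)).1])).le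
  have hle : ∀ r ∈ Ioo 0 ρ, expNonlin a (w r) ≤ expNonlin a γ := fun r hr =>
    expNonlin_mono (by linarith [(hw' r (Ioo_subset_Icc_self hr)).1])
      (hw' r (Ioo_subset_Icc_self hr)).2 (h.w_le hf hr.1.le hr.2.le)
  have hkinv : 1 / logSlope a γ ≤ 1 / γ := one_div_le_one_div_of_le hγ hL.gamma_le_logSlope
  have hcore : ∀ r ∈ Icc 0 ρ, r ^ 2 * (logSlope a γ * expNonlin a γ) ≤ 4 →
      γ - 1 / logSlope a γ ≤ w r := by
    intro r hr hr2
    have := h.w_ge_of_f_le hr.1 hr.2 hle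
    have h2 : expNonlin a γ * r ^ 2 / 4 ≤ 1 / logSlope a γ := by
      rw [le_div_iff₀ hk]; linarith
    linarith
  by_cases hcase : ρ ^ 2 * (logSlope a γ * expNonlin a γ) ≤ 4
  · have h1 := hcore ρ ⟨h.pos.le, le_rfl⟩ hcase
    have h2 : 1 / γ ≤ 7 / √γ := by
      rw [div_le_div_iff₀ hγ (by linarith)]; nlinarith [hL.sq_sqrt]
    linarith
  push Not at hcase
  set b := √(4 / (logSlope a γ * expNonlin a γ)) with hb
  have hb2 : b ^ 2 = 4 / (logSlope a γ * expNonlin a γ) := Real.sq_sqrt (by positivity)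
  have hb2' : b ^ 2 * (logSlope a γ * expNonlin a γ) = 4 := by
    rw [hb2]; field_simp
  have hb0 : 0 < b := Real.sqrt_pos.2 (by positivity)
  have hbρ : b ≤ ρ := by
    have hpos : 0 < logSlope a γ * expNonlin a γ := by positivity
    exact (pow_le_pow_iff_left₀ hb0.le h.pos.le two_ne_zero).1 (by nlinarith)
  have hwb := hcore b ⟨hb0.le, hbρ⟩ hb2'.le
  have hwbγ : w b ≤ γ := h.w_le hf hb0.le hbρ
  have hmono := h.pow_four_mul_mono hw' hb0.le hbρ le_rfl
  have hρ2 : ρ ^ 2 ≤ 4 * Real.exp (3 * √γ) * b ^ 2 := by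
    have h1 : ρ ^ 2 ≤ Real.exp (-(exitLevel a γ - √γ)) ^ 2 :=
      pow_le_pow_left₀ h.pos.le hρ 2
    have h2 : Real.exp (-(exitLevel a γ - √γ)) ^ 2 * (logSlope a γ * expNonlin a γ) =
        16 * Real.exp (3 * √γ) := by
      have e1 : -(exitLevel a γ - √γ) = -exitLevel a γ + √γ := by ring
      have e2 : (3 : ℝ) * √γ = √γ + (√γ + √γ) := by ring
      rw [e1, Real.exp_add, mul_pow, mul_right_comm, hL.exp_two_exitLevel, e2, Real.exp_add,
        Real.exp_add]
      ring
    have hpos : 0 < logSlope a γ * expNonlin a γ := by positivity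
    refine h1.trans (le_of_mul_le_mul_right ?_ hpos)
    rw [h2, mul_assoc, hb2']
    linarith
  have hρ4 : ρ ^ 4 ≤ 16 * Real.exp (6 * √γ) * b ^ 4 := by
    have := pow_le_pow_left₀ (by positivity) hρ2 2
    have e : Real.exp (6 * √γ) = Real.exp (3 * √γ) ^ 2 := by
      rw [← Real.exp_nat_mul]; push_cast; ring_nf
    rw [e]
    nlinarith
  have hwρ := hw' ρ ⟨h.pos.le, le_rfl⟩
  have hFρ := expNonlin_pos a (by linarith : 0 < w ρ)
  have hcomp : expNonlin a (w b) ≤ 16 * Real.exp (6 * √γ) * expNonlin a (w ρ) := by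
    have hb4 : 0 < b ^ 4 := by positivity
    refine le_of_mul_le_mul_left ?_ hb4
    nlinarith
  have hwb0 : 0 < w b := by linarith [(hw' b ⟨hb0.le, hbρ⟩).1]
  have hlog := Real.log_le_log (expNonlin_pos a hwb0) hcomp
  rw [Real.log_mul (by positivity) hFρ.ne', Real.log_mul (by norm_num) (Real.exp_pos _).ne',
    Real.log_exp, log_expNonlin a hwb0, log_expNonlin a (by linarith)] at hlog
  have hlog16 : Real.log 16 ≤ 15 := (Real.log_le_sub_one_of_pos (by norm_num)).trans (by norm_num)
  have hlogw : Real.log (w ρ) ≤ Real.log γ :=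
    Real.log_le_log (by linarith) (h.w_le hf h.pos.le le_rfl)
  have hinv := hL.inv_le
  have hγ2 := hL.mul_c_le
  have hc1 := hL.one_le
  have hlogb : Real.log γ - 1 ≤ Real.log (w b) := by
    have h1 := Real.log_le_sub_one_of_pos (div_pos hγ hwb0)
    rw [Real.log_div hγ.ne' hwb0.ne'] at h1
    have h2 : γ / w b ≤ 2 := by rw [div_le_iff₀ hwb0]; linarith
    linarith
  have hquad : γ ^ 2 - a * γ - 2 ≤ w b ^ 2 - a * w b := by
    have h1 : (γ - w b) * γ ≤ 1 := by
      have : (γ - w b) ≤ 1 / γ := by linarith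
      calc (γ - w b) * γ ≤ 1 / γ * γ := by gcongr
        _ = 1 := by field_simp
    nlinarith [hL.a_pos]
  have hfin : (γ - w ρ) * γ ≤ 7 * √γ := by
    have h1 : (γ - w ρ) * (γ + w ρ - a) ≤ 7 * √γ := by nlinarith
    nlinarith [h.w_le hf h.pos.le le_rfl]
  have : γ - w ρ ≤ 7 / √γ := by
    rw [le_div_iff₀ (by linarith)]
    have : (γ - w ρ) * √γ * √γ ≤ 7 * √γ := by
      rw [mul_assoc, ← pow_two, hL.sq_sqrt]; exact hfin
    exact le_of_mul_le_mul_right this (by linarith)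
  linarith

end RadialSystem

namespace RadialSystem

variable {a c ρ γ : ℝ} {w q : ℝ → ℝ}

/-- The bubble exits before `w` reaches the level `c`. -/
lemma exit_lt (h : RadialSystem (expNonlin a) ρ γ w q) (hL : IsLarge a c γ)
    (hw : ∀ r ∈ Icc 0 ρ, c ≤ w r) (hwρ : w ρ = c) :
    Real.exp (-(exitLevel a γ - √γ)) < ρ := by
  by_contra! hle
  have h1 := h.w_ge_of_le_exit hL hw hle
  have h2 : 7 / √γ ≤ 1 := by
    rw [div_le_one (by linarith [hL.hundred_le])]; linarith [hL.hundred_le]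
  linarith [hL.mul_c_le, hL.one_le]

lemma slopeLower_le (h : RadialSystem (expNonlin a) ρ γ w q) (hL : IsLarge a c γ)
    (hw : ∀ r ∈ Icc 0 ρ, c ≤ w r) {r : ℝ} (hr : Real.exp (-exitLevel a γ) ≤ r) (hrρ : r ≤ ρ) :
    slopeLower a γ / 2 ≤ q r := by
  have hk : 0 < logSlope a γ := hL.gamma_pos.trans_le hL.gamma_le_logSlope
  have hF := expNonlin_pos a hL.gamma_pos
  have hw' : ∀ r ∈ Icc 0 ρ, 1 ≤ w r ∧ a ≤ w r := fun r hr =>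
    ⟨hL.one_le.trans (hw r hr), hL.a_le.trans (hw r hr)⟩
  have hr0 : 0 < r := (Real.exp_pos _).trans_le hr
  have hq := h.q_pos hw' ⟨hr0, hrρ⟩
  have h1 := h.inv_q_le hw' ⟨hr0, hrρ⟩
  have h2 : 16 * Real.exp √γ / logSlope a γ ≤ expNonlin a γ * r ^ 2 := by
    rw [← hL.exp_two_exitLevel, div_le_iff₀ hk]
    have := pow_le_pow_left₀ (Real.exp_pos _).le hr 2
    calc _ ≤ r ^ 2 * (logSlope a γ * expNonlin a γ) := by gcongr
      _ = _ := by ring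
  have h3 : 8 / (expNonlin a γ * r ^ 2) ≤ logSlope a γ / 2 * Real.exp (-√γ) := by
    calc 8 / (expNonlin a γ * r ^ 2) ≤ 8 / (16 * Real.exp √γ / logSlope a γ) := by gcongr
      _ = _ := by rw [Real.exp_neg]; field_simp; norm_num
  have h4 : 1 / q r ≤ logSlope a γ / 2 * (1 + Real.exp (-√γ)) := by linarith
  rw [div_le_iff₀ hq] at h4
  unfold slopeLower
  rw [div_div, div_le_iff₀ (by positivity)]
  linarith

lemma w_le_line (h : RadialSystem (expNonlin a) ρ γ w q) (hL : IsLarge a c γ)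
    (hw : ∀ r ∈ Icc 0 ρ, c ≤ w r) {r : ℝ} (hr : Real.exp (-exitLevel a γ) ≤ r) (hrρ : r ≤ ρ) :
    w r ≤ γ - slopeLower a γ * (exitLevel a γ + Real.log r) := by
  have hf : ∀ r ∈ Ioo 0 ρ, 0 ≤ expNonlin a (w r) := fun r hr =>
    (expNonlin_pos a (by linarith [hw r (Ioo_subset_Icc_self hr), hL.one_le])).le
  have h1 := h.w_le_of_le_q (Q := slopeLower a γ / 2) (Real.exp_pos _) hr hrρ fun s hs =>
    h.slopeLower_le hL hw hs.1.le (hs.2.le.trans hrρ)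
  rw [Real.log_exp] at h1
  have h2 := h.w_le hf (Real.exp_pos _).le (hr.trans hrρ)
  linarith

lemma lt_one_of_eq (h : RadialSystem (expNonlin a) ρ γ w q) (hL : IsLarge a c γ)
    (hw : ∀ r ∈ Icc 0 ρ, c ≤ w r) (hwρ : w ρ = c) : ρ < 1 := by
  have hex : Real.exp (-exitLevel a γ) ≤ ρ := by
    refine le_trans (Real.exp_le_exp.2 ?_) (h.exit_lt hL hw hwρ).le
    linarith [hL.hundred_le]
  have h1 := h.w_le_line hL hw hex le_rfl
  have h2 : slopeLower a γ * Real.log ρ < 0 := by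
    have := hL.line_lt
    linarith
  have h3 : Real.log ρ < 0 := by
    by_contra! h0
    linarith [mul_nonneg hL.slopeLower_pos.le h0]
  exact (Real.log_neg_iff h.pos).1 h3

lemma energy_small (h : RadialSystem (expNonlin a) ρ γ w q) (hL : IsLarge a c γ)
    (hw : ∀ r ∈ Icc 0 ρ, c ≤ w r) {r : ℝ}
    (hr : Real.exp (-(exitLevel a γ - √γ)) ≤ r) (hrρ : r ≤ ρ) :
    r ^ 2 * expNonlin a (w r) ≤ Real.exp (-√γ / 2) := by
  have hf : ∀ r ∈ Ioo 0 ρ, 0 ≤ expNonlin a (w r) := fun r hr =>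
    (expNonlin_pos a (by linarith [hw r (Ioo_subset_Icc_self hr), hL.one_le])).le
  have hr0 : 0 < r := (Real.exp_pos _).trans_le hr
  have hwr := hw r ⟨hr0.le, hrρ⟩
  have hw0 : 0 < w r := by linarith [hL.one_le]
  have hs := hL.slopeLower_pos
  have hline := h.w_le_line hL hw
    (le_trans (Real.exp_le_exp.2 (by linarith [hL.hundred_le])) hr) hrρ
  set x := γ - slopeLower a γ * (exitLevel a γ + Real.log r) with hx
  have hlogr : -(exitLevel a γ - √γ) ≤ Real.log r := by
    rw [← Real.log_exp (-(exitLevel a γ - √γ))]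
    exact Real.log_le_log (Real.exp_pos _) hr
  have hx1 : x ≤ γ - slopeLower a γ * √γ := by
    have : slopeLower a γ * √γ ≤ slopeLower a γ * (exitLevel a γ + Real.log r) := by
      gcongr; linarith
    linarith
  have hexp := hL.exponent_le (hwr.trans hline) hx1
  have hlogw : Real.log (w r) ≤ Real.log γ := Real.log_le_log hw0 (h.w_le hf hr0.le hrρ)
  have hquad : w r ^ 2 - a * w r ≤ x ^ 2 - a * x := by nlinarith [hL.a_le, hL.one_le]
  have hF := expNonlin_pos a hw0
  rw [← Real.log_le_iff_le_exp (by positivity), Real.log_mul (by positivity) hF.ne', Real.log_pow,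
    log_expNonlin a hw0]
  have h2r : 2 * Real.log r = 2 / slopeLower a γ * (γ - x) - 2 * exitLevel a γ := by
    rw [hx]; field_simp; ring
  have h2e : 2 * exitLevel a γ =
      Real.log γ + (γ ^ 2 - a * γ) + Real.log (logSlope a γ / 16) - √γ := by
    rw [exitLevel, log_expNonlin a hL.gamma_pos]; ring
  push_cast
  nlinarith

lemma q_le_massUpper (h : RadialSystem (expNonlin a) ρ γ w q) (hL : IsLarge a c γ)
    (hw : ∀ r ∈ Icc 0 ρ, c ≤ w r) (hwρ : w ρ = c) : q ρ ≤ massUpper a γ := by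
  have hw' : ∀ r ∈ Icc 0 ρ, 1 ≤ w r ∧ a ≤ w r := fun r hr =>
    ⟨hL.one_le.trans (hw r hr), hL.a_le.trans (hw r hr)⟩
  have hex := h.exit_lt hL hw hwρ
  set s := Real.exp (-(exitLevel a γ - √γ)) with hs
  have hs0 : 0 < s := Real.exp_pos _
  have hsρ : s ∈ Ioc 0 ρ := ⟨hs0, hex.le⟩
  have hws : γ - 7 / √γ ≤ w s := (h.restrict hs0 hex.le).w_ge_of_le_exit hL
    (fun r hr => hw r ⟨hr.1, hr.2.trans hex.le⟩) le_rfl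
  have h1 := h.logSlope_mul_q_le hw' hsρ
  have hq := h.q_pos hw' hsρ
  have hf : ∀ r ∈ Ioo 0 ρ, 0 ≤ expNonlin a (w r) := fun r hr =>
    (expNonlin_pos a (by linarith [hw r (Ioo_subset_Icc_self hr), hL.one_le])).le
  have h2 : logSlope a γ - 14 / √γ ≤ logSlope a (w s) := by
    unfold logSlope
    have h0 : 0 < w s := by linarith [(hw' s (Ioc_subset_Icc_self hsρ)).1]
    have : 1 / γ ≤ 1 / w s := one_div_le_one_div_of_le h0 (h.w_le hf hs0.le hex.le)
    have e : 14 / √γ = 2 * (7 / √γ) := by ring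
    linarith
  have h3 : 0 < logSlope a γ - 14 / √γ := by
    have : 14 / √γ ≤ 1 := by
      rw [div_le_one (by linarith [hL.hundred_le])]; linarith [hL.hundred_le]
    linarith [hL.gamma_le_logSlope, hL.mul_c_le, hL.one_le]
  have h4 : q s ≤ 2 / (logSlope a γ - 14 / √γ) := by
    rw [le_div_iff₀ h3]; nlinarith
  have h5 := le_of_hasDerivAt_nonpos
    (f := fun r => q r - Real.exp (-√γ / 2) / 2 * Real.log r)
    (f' := fun r => r * expNonlin a (w r) / 2 - Real.exp (-√γ / 2) / 2 * r⁻¹) hex.le ?_ ?_ ?_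
  · have hlogs : Real.log s = -(exitLevel a γ - √γ) := by rw [hs, Real.log_exp]
    have hlogρ : Real.log ρ ≤ 0 :=
      Real.log_nonpos h.pos.le (h.lt_one_of_eq hL hw hwρ).le
    simp only [hlogs] at h5
    have hE := Real.exp_pos (-√γ / 2)
    unfold massUpper
    have h6 := hL.exit_ge
    nlinarith [mul_nonneg hE.le (sub_nonneg.2 h6)]
  · refine (h.cont_q.mono (Icc_subset_Icc hs0.le le_rfl)).sub (continuousOn_const.mul ?_)
    exact Real.continuousOn_log.mono fun r hr => (hs0.trans_le hr.1).ne'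
  · intro r hr
    have h0 : 0 < r := hs0.trans hr.1
    exact (h.deriv_q r ⟨h0, hr.2⟩).sub ((Real.hasDerivAt_log h0.ne').const_mul _)
  · intro r hr
    have h0 : 0 < r := hs0.trans hr.1
    have := h.energy_small hL hw hr.1.le hr.2.le
    have e : r * expNonlin a (w r) / 2 - Real.exp (-√γ / 2) / 2 * r⁻¹ =
        (r ^ 2 * expNonlin a (w r) - Real.exp (-√γ / 2)) / (2 * r) := by field_simp
    rw [e]
    exact div_nonpos_of_nonpos_of_nonneg (by linarith) (by linarith)

lemma log_le_of_eq (h : RadialSystem (expNonlin a) ρ γ w q) (hL : IsLarge a c γ)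
    (hw : ∀ r ∈ Icc 0 ρ, c ≤ w r) (hwρ : w ρ = c) :
    γ - 7 / √γ - 2 * massUpper a γ * (exitLevel a γ - √γ + Real.log ρ) ≤ c := by
  have hf : ∀ r ∈ Ioo 0 ρ, 0 ≤ expNonlin a (w r) := fun r hr =>
    (expNonlin_pos a (by linarith [hw r (Ioo_subset_Icc_self hr), hL.one_le])).le
  have hex := h.exit_lt hL hw hwρ
  have hs0 := Real.exp_pos (-(exitLevel a γ - √γ))
  have hws := (h.restrict hs0 hex.le).w_ge_of_le_exit hL
    (fun r hr => hw r ⟨hr.1, hr.2.trans hex.le⟩) le_rfl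
  have h1 := h.w_ge_of_q_le hs0 hex.le le_rfl (Q := massUpper a γ) fun r hr =>
    (h.q_mono hf (hs0.trans hr.1).le hr.2.le le_rfl).trans (h.q_le_massUpper hL hw hwρ)
  rw [Real.log_exp, hwρ] at h1
  linarith

end RadialSystem

lemma tendsto_sqrt_div_self : Tendsto (fun γ : ℝ => √γ / γ) atTop (𝓝 0) := by
  refine (tendsto_inv_atTop_zero.comp Real.tendsto_sqrt_atTop).congr' ?_
  filter_upwards [eventually_gt_atTop 0] with γ hγ
  have : 0 < √γ := Real.sqrt_pos.2 hγ
  simp only [Function.comp]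
  rw [eq_div_iff hγ.ne', inv_mul_eq_div, div_eq_iff this.ne', Real.mul_self_sqrt hγ.le]

lemma tendsto_inv_sqrt : Tendsto (fun γ : ℝ => 1 / √γ) atTop (𝓝 0) := by
  simp only [one_div]
  exact tendsto_inv_atTop_zero.comp Real.tendsto_sqrt_atTop

lemma tendsto_log_div_self : Tendsto (fun γ : ℝ => Real.log γ / γ) atTop (𝓝 0) :=
  Real.isLittleO_log_id_atTop.tendsto_div_nhds_zero

lemma tendsto_pow_mul_exp_neg_sqrt_half (n : ℕ) :
    Tendsto (fun γ : ℝ => γ ^ n * Real.exp (-√γ / 2)) atTop (𝓝 0) := by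
  have h1 : Tendsto (fun γ : ℝ => √γ / 2) atTop atTop :=
    Real.tendsto_sqrt_atTop.atTop_div_const (by norm_num)
  have h2 := ((Real.tendsto_pow_mul_exp_neg_atTop_nhds_zero (2 * n)).comp h1).const_mul (4 ^ n)
  rw [mul_zero] at h2
  refine h2.congr' ?_
  filter_upwards [eventually_gt_atTop 0] with γ hγ
  simp only [Function.comp]
  rw [pow_mul, div_pow, Real.sq_sqrt hγ.le, neg_div, ← mul_assoc, ← mul_pow]
  norm_num
  congr 1
  ring

lemma tendsto_pow_mul_exp_neg_sqrt (n : ℕ) :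
    Tendsto (fun γ : ℝ => γ ^ n * Real.exp (-√γ)) atTop (𝓝 0) := by
  have h := (tendsto_pow_mul_exp_neg_sqrt_half n).mul (tendsto_pow_mul_exp_neg_sqrt_half 0)
  rw [mul_zero] at h
  refine h.congr fun γ => ?_
  rw [pow_zero, one_mul, mul_assoc, ← Real.exp_add]
  ring_nf

lemma tendsto_logSlope_div (a : ℝ) : Tendsto (fun γ => logSlope a γ / γ) atTop (𝓝 2) := by
  have h1 : Tendsto (fun γ : ℝ => 2 - a * γ⁻¹ + γ⁻¹ * γ⁻¹) atTop (𝓝 (2 - a * 0 + 0 * 0)) :=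
    (tendsto_const_nhds.sub (tendsto_inv_atTop_zero.const_mul a)).add
      (tendsto_inv_atTop_zero.mul tendsto_inv_atTop_zero)
  rw [mul_zero, mul_zero, sub_zero, add_zero] at h1
  refine h1.congr' ?_
  filter_upwards [eventually_gt_atTop 0] with γ hγ
  unfold logSlope
  field_simp

/-- The lower-order part of `2 * exitLevel a γ`. -/
def exitRemainder (a γ : ℝ) : ℝ := Real.log γ + Real.log (logSlope a γ / 16) - √γ

lemma two_mul_exitLevel (a : ℝ) {γ : ℝ} (hγ : 0 < γ) :
    2 * exitLevel a γ = γ ^ 2 - a * γ + exitRemainder a γ := by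
  unfold exitLevel exitRemainder
  rw [log_expNonlin a hγ]
  ring

lemma tendsto_exitRemainder_div (a : ℝ) :
    Tendsto (fun γ => exitRemainder a γ / γ) atTop (𝓝 0) := by
  have hk := tendsto_logSlope_div a
  have h1 : Tendsto (fun γ => Real.log (logSlope a γ / γ / 16) * γ⁻¹) atTop
      (𝓝 (Real.log (2 / 16) * 0)) :=
    ((hk.div_const 16).log (by norm_num)).mul tendsto_inv_atTop_zero
  have h2 := ((tendsto_log_div_self.const_mul 2).add h1).sub tendsto_sqrt_div_self
  rw [mul_zero, mul_zero, add_zero, sub_zero] at h2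
  refine h2.congr' ?_
  filter_upwards [eventually_gt_atTop 0, hk.eventually (lt_mem_nhds (by norm_num : (1:ℝ) < 2))]
    with γ hγ hγk
  have hpos : 0 < logSlope a γ / γ / 16 := by linarith
  have : Real.log (logSlope a γ / 16) = Real.log (logSlope a γ / γ / 16) + Real.log γ := by
    rw [← Real.log_mul hpos.ne' hγ.ne']
    congr 1
    field_simp
  rw [exitRemainder, this]
  field_simp
  ring

lemma tendsto_line (a : ℝ) :
    Tendsto (fun γ => γ - slopeLower a γ * exitLevel a γ) atTop (𝓝 (a / 2)) := by
  have hk := tendsto_logSlope_div a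
  have hE1 := tendsto_pow_mul_exp_neg_sqrt 1
  have hE0 := tendsto_pow_mul_exp_neg_sqrt 0
  have hR := tendsto_exitRemainder_div a
  have hnum := ((tendsto_inv_atTop_zero (𝕜 := ℝ)).const_add a).add (hk.mul hE1) |>.sub
    (hR.const_mul 2)
  have hden := hk.mul (hE0.const_add 1)
  have h := hnum.div hden (by norm_num)
  have e : (a + 0 + 2 * 0 - 2 * 0) / (2 * (1 + 0)) = a / 2 := by ring
  rw [e] at h
  refine h.congr' ?_
  filter_upwards [eventually_gt_atTop 0, hk.eventually (lt_mem_nhds (by norm_num : (1:ℝ) < 2))]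
    with γ hγ hγk
  have hk0 : 0 < logSlope a γ := by
    have := (one_lt_div hγ).1 hγk
    linarith
  have hL : exitLevel a γ = (γ ^ 2 - a * γ + exitRemainder a γ) / 2 := by
    rw [← two_mul_exitLevel a hγ]; ring
  have hkγ : logSlope a γ * γ = 2 * γ ^ 2 - a * γ + 1 := by
    unfold logSlope; field_simp
  simp only [Pi.div_apply, pow_one, pow_zero, one_mul]
  rw [hL, slopeLower]
  have hE := Real.exp_pos (-√γ)
  rw [div_eq_iff (by positivity)]
  field_simp
  linear_combination (-2 : ℝ) * hkγ

lemma tendsto_exitLevel_div (a : ℝ) :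
    Tendsto (fun γ => (exitLevel a γ - √γ) / γ ^ 2) atTop (𝓝 (1 / 2)) := by
  have hR := tendsto_exitRemainder_div a
  have hi := tendsto_inv_atTop_zero (𝕜 := ℝ)
  have h := (((hi.const_mul a).const_sub 1).add (hR.mul hi)).div_const 2 |>.sub
    (tendsto_sqrt_div_self.mul hi)
  have e : (1 - a * 0 + 0 * 0) / 2 - 0 * 0 = (1 / 2 : ℝ) := by ring
  rw [e] at h
  refine h.congr' ?_
  filter_upwards [eventually_gt_atTop 0] with γ hγ
  have hL : exitLevel a γ = (γ ^ 2 - a * γ + exitRemainder a γ) / 2 := by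
    rw [← two_mul_exitLevel a hγ]; ring
  rw [hL]
  field_simp

lemma tendsto_logSlope_sub_div (a : ℝ) :
    Tendsto (fun γ => (logSlope a γ - 14 / √γ) / γ) atTop (𝓝 2) := by
  have h := (tendsto_logSlope_div a).sub
    ((tendsto_inv_sqrt.mul tendsto_inv_atTop_zero).const_mul 14)
  rw [mul_zero, mul_zero, sub_zero] at h
  refine h.congr fun γ => ?_
  ring

lemma tendsto_massUpper_mul (a : ℝ) : Tendsto (fun γ => massUpper a γ * γ) atTop (𝓝 1) := by
  have h := ((tendsto_logSlope_sub_div a).inv₀ two_ne_zero).const_mul 2 |>.add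
    ((tendsto_pow_mul_exp_neg_sqrt_half 3).mul (tendsto_exitLevel_div a))
  have e : (2 : ℝ) * 2⁻¹ + 0 * (1 / 2) = 1 := by norm_num
  rw [e] at h
  refine h.congr' ?_
  filter_upwards [eventually_gt_atTop 0] with γ hγ
  rw [massUpper, inv_div]
  field_simp

lemma tendsto_line_lower (a : ℝ) :
    Tendsto (fun γ => γ - 7 / √γ - 2 * massUpper a γ * (exitLevel a γ - √γ)) atTop
      (𝓝 (a / 2)) := by
  have hR := tendsto_exitRemainder_div a
  have hi := tendsto_inv_atTop_zero (𝕜 := ℝ)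
  have hS := tendsto_inv_sqrt
  have hk := tendsto_logSlope_sub_div a
  have hnum := (((hi.const_add a).sub (hS.const_mul 14)).sub (hR.const_mul 2)).add
    (tendsto_sqrt_div_self.const_mul 4)
  have hmain := hnum.div hk two_ne_zero
  have hx := tendsto_exitLevel_div a
  have h := (hmain.sub (hS.const_mul 7)).sub
    (((tendsto_pow_mul_exp_neg_sqrt_half 4).mul (hx.mul hx)).const_mul 2)
  have e : (a + 0 - 14 * 0 - 2 * 0 + 4 * 0) / 2 - 7 * 0 - 2 * (0 * (1 / 2 * (1 / 2))) = a / 2 := by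
    ring
  rw [e] at h
  refine h.congr' ?_
  filter_upwards [eventually_gt_atTop 0, hk.eventually (lt_mem_nhds (by norm_num : (1:ℝ) < 2))]
    with γ hγ hγk
  have hk0 : 0 < logSlope a γ - 14 / √γ := by
    have := (one_lt_div hγ).1 hγk
    linarith
  have hL : exitLevel a γ = (γ ^ 2 - a * γ + exitRemainder a γ) / 2 := by
    rw [← two_mul_exitLevel a hγ]; ring
  have hkγ : (logSlope a γ - 14 / √γ) * γ = 2 * γ ^ 2 - a * γ + 1 - 14 * (1 / √γ) * γ := by
    unfold logSlope; field_simp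
  have hfirst : (a + γ⁻¹ - 14 * (1 / √γ) - 2 * (exitRemainder a γ / γ) + 4 * (√γ / γ)) /
      ((logSlope a γ - 14 / √γ) / γ) =
      γ - 2 * (2 / (logSlope a γ - 14 / √γ)) * (exitLevel a γ - √γ) := by
    rw [hL]
    generalize logSlope a γ - 14 / √γ = K at hk0 hkγ
    generalize 1 / √γ = z at hkγ
    rw [div_eq_iff (by positivity)]
    field_simp
    linear_combination (-1 : ℝ) * hkγ
  simp only [Pi.div_apply]
  rw [hfirst, massUpper]
  field_simp
  ring

lemma eventually_isLarge {a c : ℝ} (h1 : 1 ≤ c) (h2 : a / 2 + 2 ≤ c) (h3 : a ≤ c) (ha : 0 < a) :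
    ∀ᶠ γ in atTop, IsLarge a c γ := by
  filter_upwards [eventually_gt_atTop 0, Real.tendsto_sqrt_atTop.eventually_ge_atTop (100 * c),
    (tendsto_line a).eventually (gt_mem_nhds (by linarith : a / 2 < c)),
    (tendsto_exitLevel_div a).eventually (lt_mem_nhds (by norm_num : (0 : ℝ) < 1 / 2))]
    with γ h0 hs hl he
  refine ⟨h1, h2, h3, ha, hs, ?_, hl⟩
  have := (div_pos_iff_of_pos_right (by positivity)).1 he
  linarith

lemma tendsto_matching_radius : Tendsto (fun γ : ℝ => γ ^ (-(3 / 4) : ℝ)) atTop (𝓝 0) :=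
  tendsto_rpow_neg_atTop (by norm_num)

lemma tendsto_logSlope_mul_radius_sq (a : ℝ) :
    Tendsto (fun γ : ℝ => logSlope a γ * (γ ^ (-(3 / 4) : ℝ)) ^ 2) atTop (𝓝 0) := by
  have h := (tendsto_logSlope_div a).mul
    (tendsto_rpow_neg_atTop (by norm_num : (0 : ℝ) < 1 / 2))
  rw [mul_zero] at h
  refine h.congr' ?_
  filter_upwards [eventually_gt_atTop 0] with γ hγ
  have : (γ ^ (-(3 / 4) : ℝ)) ^ 2 = γ ^ (-(1 / 2) : ℝ) / γ := by
    rw [← Real.rpow_natCast, ← Real.rpow_mul hγ.le, eq_div_iff hγ.ne']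
    nth_rw 2 [← Real.rpow_one γ]
    rw [← Real.rpow_add hγ]
    norm_num
  rw [this]
  ring

lemma tendsto_slopeLower_mul_log_radius (a : ℝ) :
    Tendsto (fun γ : ℝ => slopeLower a γ * Real.log (γ ^ (-(3 / 4) : ℝ))) atTop (𝓝 0) := by
  have hk := tendsto_logSlope_div a
  have hden := hk.mul ((tendsto_pow_mul_exp_neg_sqrt 0).const_add 1)
  have h := ((hden.inv₀ (by norm_num)).mul tendsto_log_div_self).const_mul (-3)
  rw [mul_zero, mul_zero] at h
  refine h.congr' ?_
  filter_upwards [eventually_gt_atTop 0] with γ hγ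
  rw [Real.log_rpow hγ, slopeLower, pow_zero, one_mul, div_mul_eq_mul_div, inv_div]
  field_simp

lemma tendsto_massUpper_div_radius (a : ℝ) :
    Tendsto (fun γ : ℝ => massUpper a γ / γ ^ (-(3 / 4) : ℝ)) atTop (𝓝 0) := by
  have h := (tendsto_massUpper_mul a).mul
    (tendsto_rpow_neg_atTop (by norm_num : (0 : ℝ) < 1 / 4))
  rw [mul_zero] at h
  refine h.congr' ?_
  filter_upwards [eventually_gt_atTop 0] with γ hγ
  rw [eq_div_iff (Real.rpow_pos_of_pos hγ _).ne', mul_assoc, mul_assoc,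
    ← Real.rpow_add hγ]
  nth_rw 2 [← Real.rpow_one γ]
  rw [← Real.rpow_add hγ]
  norm_num

/-- The structural assumptions on the nonlinearity `f(t) = t g(t)`. -/
structure IsCritical (a c : ℝ) (f : ℝ → ℝ) : Prop where
  a_pos : 0 < a
  cont : ContinuousOn f (Ici 0)
  nonneg : ∀ x, 0 ≤ x → 0 ≤ f x
  eq_exp : ∀ x, c ≤ x → f x = expNonlin a x

lemma IsLarge.one_div_le_slopeLower {a c γ : ℝ} (hL : IsLarge a c γ) :
    1 / logSlope a γ ≤ slopeLower a γ / 2 := by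
  have hk : 0 < logSlope a γ := hL.gamma_pos.trans_le hL.gamma_le_logSlope
  have hE : Real.exp (-√γ) ≤ 1 := Real.exp_le_one_iff.2 (by linarith [hL.hundred_le])
  have hE0 := Real.exp_pos (-√γ)
  unfold slopeLower
  rw [div_div, div_le_div_iff₀ hk (by positivity)]
  nlinarith

/-- Matching: at the radius `γ ^ (-3/4)`, `w` is close to `a / 2` with small slope. -/
lemma IsCritical.matching {a c₀ : ℝ} {f : ℝ → ℝ} (hf : IsCritical a c₀ f) {ε : ℝ} (hε : 0 < ε) :
    ∀ᶠ γ in atTop, ∀ R w q, RadialSystem f R γ w q → (∀ r ∈ Ico 0 R, 0 < w r) → w R = 0 →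
      γ ^ (-(3 / 4) : ℝ) < R ∧ |w (γ ^ (-(3 / 4) : ℝ)) - a / 2| < ε ∧
        |q (γ ^ (-(3 / 4) : ℝ)) / γ ^ (-(3 / 4) : ℝ)| < ε := by
  have ha := hf.a_pos
  obtain ⟨c, hc1, hc2, hc3, hc0⟩ : ∃ c : ℝ, 1 ≤ c ∧ a / 2 + 2 ≤ c ∧ a ≤ c ∧ c₀ ≤ c :=
    ⟨max (max 1 (a / 2 + 2)) (max a c₀), by simp, by simp, by simp, by simp⟩
  obtain ⟨C, hC⟩ := isCompact_Icc.bddAbove_image (hf.cont.mono (Icc_subset_Ici_self : Icc 0 c ⊆ Ici 0))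
  have hCf : ∀ x ∈ Icc 0 c, f x ≤ C := fun x hx => hC (mem_image_of_mem f hx)
  have hC0 : 0 ≤ C := (hf.nonneg 0 le_rfl).trans (hCf 0 ⟨le_rfl, by linarith⟩)
  have hlow : Tendsto (fun γ => (γ - 7 / √γ - 2 * massUpper a γ * (exitLevel a γ - √γ)) -
      C / 4 * ((logSlope a γ * (γ ^ (-(3 / 4) : ℝ)) ^ 2) *
        (c - (γ - 7 / √γ - 2 * massUpper a γ * (exitLevel a γ - √γ))))) atTop (𝓝 (a / 2)) := by
    have h := (tendsto_line_lower a).sub (((tendsto_logSlope_mul_radius_sq a).mul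
      ((tendsto_line_lower a).const_sub c)).const_mul (C / 4))
    rwa [zero_mul, mul_zero, sub_zero] at h
  have hup : Tendsto (fun γ => γ - slopeLower a γ * exitLevel a γ -
      slopeLower a γ * Real.log (γ ^ (-(3 / 4) : ℝ))) atTop (𝓝 (a / 2)) := by
    have h := (tendsto_line a).sub (tendsto_slopeLower_mul_log_radius a)
    rwa [sub_zero] at h
  have hslope : Tendsto (fun γ => massUpper a γ / γ ^ (-(3 / 4) : ℝ) +
      C / 4 * γ ^ (-(3 / 4) : ℝ)) atTop (𝓝 0) := by
    have h := (tendsto_massUpper_div_radius a).add (tendsto_matching_radius.const_mul (C / 4))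
    rwa [mul_zero, add_zero] at h
  filter_upwards [eventually_isLarge hc1 hc2 hc3 ha,
    hlow.eventually (lt_mem_nhds (by linarith : a / 2 - ε < a / 2)),
    hlow.eventually (lt_mem_nhds (by linarith : 0 < a / 2)),
    hup.eventually (gt_mem_nhds (by linarith : a / 2 < a / 2 + ε)),
    hup.eventually (gt_mem_nhds (by linarith : a / 2 < c)),
    hslope.eventually (gt_mem_nhds hε),
    tendsto_matching_radius.eventually (gt_mem_nhds zero_lt_one)]
    with γ hL hlowε hlow0 hupε hupc hsl hρ1 R w q h hpos hend
  have hρ0 : 0 < γ ^ (-(3 / 4) : ℝ) := Real.rpow_pos_of_pos hL.gamma_pos _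
  generalize γ ^ (-(3 / 4) : ℝ) = ρ at *
  have hw0 : ∀ r ∈ Icc 0 R, 0 ≤ w r := fun r hr => by
    rcases hr.2.eq_or_lt with rfl | hlt
    · exact hend.ge
    · exact (hpos r ⟨hr.1, hlt⟩).le
  have hfn : ∀ r ∈ Ioo 0 R, 0 ≤ f (w r) := fun r hr =>
    hf.nonneg _ (hw0 r (Ioo_subset_Icc_self hr))
  have hcγ : c < γ := by linarith [hL.mul_c_le]
  obtain ⟨b, hb, hwb⟩ : ∃ b ∈ Ioo 0 R, w b = c := by
    have := intermediate_value_Ioo' h.pos.le h.cont_w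
    rw [h.w_zero, hend] at this
    exact this ⟨by linarith, hcγ⟩
  have hwc : ∀ r ∈ Icc 0 b, c ≤ w r := fun r hr =>
    hwb ▸ h.w_anti hfn hr.1 hr.2 hb.2.le
  have hB : RadialSystem (expNonlin a) b γ w q := (h.restrict hb.1 hb.2.le).congr fun r hr =>
    hf.eq_exp _ (hc0.trans (hwc r (Ioo_subset_Icc_self hr)))
  have hs := hL.slopeLower_pos
  have hk : 0 < logSlope a γ := hL.gamma_pos.trans_le hL.gamma_le_logSlope
  have hexit : Real.exp (-exitLevel a γ) ≤ b := by
    refine le_trans (Real.exp_le_exp.2 ?_) (hB.exit_lt hL hwc hwb).le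
    linarith [hL.hundred_le]
  have hline := hB.w_le_line hL hwc hexit le_rfl
  rw [hwb] at hline
  have hbρ : b < ρ := by
    have : slopeLower a γ * Real.log b < slopeLower a γ * Real.log ρ := by linarith
    exact (Real.log_lt_log_iff hb.1 hρ0).1 (lt_of_mul_lt_mul_left this hs.le)
  have hm := hB.q_le_massUpper hL hwc hwb
  have hm1 : 1 / logSlope a γ ≤ massUpper a γ :=
    hL.one_div_le_slopeLower.trans ((hB.slopeLower_le hL hwc hexit le_rfl).trans hm)
  have hlogb : Real.log b < 0 := Real.log_neg hb.1 (hB.lt_one_of_eq hL hwc hwb)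
  have hBl := hB.log_le_of_eq hL hwc hwb
  have hq : ∀ r, b ≤ r → r ≤ ρ → r ≤ R → q r ≤ massUpper a γ + C * ρ ^ 2 / 4 := by
    intro r hbr hrρ hrR
    have h1 := h.q_le_of_f_le hb.1.le hbr hrR (M := C) fun s hs => hCf _
      ⟨hw0 s ⟨(hb.1.trans hs.1).le, hs.2.le.trans hrR⟩,
        hwb ▸ h.w_anti hfn hb.1.le hs.1.le (hs.2.le.trans hrR)⟩
    have h2 : C * (r ^ 2 - b ^ 2) ≤ C * ρ ^ 2 := by
      gcongr
      nlinarith [sq_nonneg b, hb.1]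
    linarith
  have hlower : ∀ r, b ≤ r → r ≤ ρ → r ≤ R →
      γ - 7 / √γ - 2 * massUpper a γ * (exitLevel a γ - √γ) - C / 4 * (logSlope a γ * ρ ^ 2 *
        (c - (γ - 7 / √γ - 2 * massUpper a γ * (exitLevel a γ - √γ)))) ≤ w r := by
    intro r hbr hrρ hrR
    have h1 := h.w_ge_of_q_le hb.1 hbr hrR (Q := massUpper a γ + C * ρ ^ 2 / 4) fun s hs =>
      hq s hs.1.le (hs.2.le.trans hrρ) (hs.2.le.trans hrR)
    rw [hwb] at h1
    have hlogr : Real.log r ≤ 0 :=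
      Real.log_nonpos (hb.1.le.trans hbr) (hrρ.trans hρ1.le)
    generalize γ - 7 / √γ = T at *
    generalize exitLevel a γ - √γ = D at *
    generalize massUpper a γ = m at *
    have hm0 : 0 < m := (one_div_pos.2 hk).trans_le hm1
    have hL1 : -Real.log b ≤ logSlope a γ * (c - (T - 2 * m * D)) / 2 := by
      have h2 : 2 * m * (-Real.log b) ≤ c - (T - 2 * m * D) := by linarith
      have h3 : 1 ≤ logSlope a γ * m := by
        rw [div_le_iff₀ hk] at hm1; linarith
      have h4 := mul_le_mul_of_nonneg_left h2 hk.le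
      nlinarith
    have h5 : C * ρ ^ 2 / 2 * (-Real.log b) ≤
        C * ρ ^ 2 / 2 * (logSlope a γ * (c - (T - 2 * m * D)) / 2) := by gcongr
    have h6 : (m + C * ρ ^ 2 / 4) * Real.log r ≤ 0 :=
      mul_nonpos_of_nonneg_of_nonpos (by positivity) hlogr
    linarith
  have hρR : ρ < R := by
    by_contra! hle
    have := hlower R hb.2.le hle le_rfl
    linarith
  refine ⟨hρR, ?_, ?_⟩
  · rw [abs_lt]
    constructor
    · linarith [hlower ρ hbρ.le le_rfl hρR.le]
    · have h1 := h.w_le_of_le_q hb.1 hbρ.le hρR.le (Q := slopeLower a γ / 2) fun s hs =>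
        (hB.slopeLower_le hL hwc hexit le_rfl).trans
          (h.q_mono hfn hb.1.le hs.1.le (hs.2.le.trans hρR.le))
      rw [hwb] at h1
      linarith
  · have hq0 := h.q_nonneg hfn hρ0.le hρR.le
    rw [abs_of_nonneg (by positivity)]
    refine lt_of_le_of_lt ?_ hsl
    rw [div_le_iff₀ hρ0, add_mul, div_mul_cancel₀ _ hρ0.ne']
    linarith [hq ρ hbρ.le le_rfl hρR.le]

namespace RadialSystem

variable {f : ℝ → ℝ} {ρ γ : ℝ} {w q : ℝ → ℝ}

lemma q_pos_of_lt (h : RadialSystem f ρ γ w q) (hf : ∀ r ∈ Ioo 0 ρ, 0 ≤ f (w r)) {x : ℝ}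
    (hx : 0 ≤ x) (hxρ : x ≤ ρ) (hw : w x < γ) : 0 < q x := by
  by_contra! hq
  have := le_of_hasDerivAt_nonneg (f' := fun r => -2 * q r / r) hx
    (h.cont_w.mono (Icc_subset_Icc le_rfl hxρ))
    (fun r hr => h.deriv_w r ⟨hr.1, hr.2.trans_le hxρ⟩) (fun r hr => ?_)
  · rw [h.w_zero] at this
    linarith
  · have := h.q_mono hf hr.1.le hr.2.le hxρ
    exact div_nonneg (by linarith) hr.1.le

/-- Near the origin `w` is close to its central value, with small slope. -/
lemma eventually_near_zero (h : RadialSystem f ρ γ w q) (hf : ∀ r ∈ Ioo 0 ρ, 0 ≤ f (w r)) {M : ℝ}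
    (hM : ∀ r ∈ Ioo 0 ρ, f (w r) ≤ M) {ε : ℝ} (hε : 0 < ε) :
    ∃ η > 0, η ≤ ρ ∧ ∀ x, 0 < x → x < η → |w x - γ| < ε ∧ |q x / x| < ε := by
  have hM0 : 0 ≤ M := (hf (ρ / 2) ⟨half_pos h.pos, half_lt_self h.pos⟩).trans
    (hM (ρ / 2) ⟨half_pos h.pos, half_lt_self h.pos⟩)
  refine ⟨min (min ρ 1) (ε / (M + 1)), lt_min (lt_min h.pos one_pos) (by positivity),
    (min_le_left _ _).trans (min_le_left _ _), fun x hx hxη => ?_⟩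
  rw [lt_min_iff, lt_min_iff, lt_div_iff₀ (by linarith)] at hxη
  obtain ⟨⟨hxρ, hx1⟩, hxε⟩ := hxη
  have hw1 := h.w_ge_of_f_le hx.le hxρ.le hM
  have hw2 := h.w_le hf hx.le hxρ.le
  have hq1 := h.q_nonneg hf hx.le hxρ.le
  have hq2 := h.q_le_of_f_le le_rfl hx.le hxρ.le fun r hr => hM r ⟨hr.1, hr.2.trans hxρ⟩
  rw [h.q_zero] at hq2
  have hMx : 0 ≤ M * x := by positivity
  constructor
  · rw [abs_sub_lt_iff]
    constructor <;> nlinarith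
  · rw [abs_of_nonneg (by positivity), div_lt_iff₀ hx]
    nlinarith

/-- A Grönwall estimate for two radial systems, in the norm `|w|² + |w'|²`. -/
lemma dist_le {f₁ f₂ : ℝ → ℝ} {ρ₁ ρ₂ γ₁ γ₂ : ℝ} {w₁ w₂ q₁ q₂ : ℝ → ℝ}
    (h₁ : RadialSystem f₁ ρ₁ γ₁ w₁ q₁) (h₂ : RadialSystem f₂ ρ₂ γ₂ w₂ q₂) {x y L δ : ℝ}
    (hx : 0 < x) (hxy : x ≤ y) (hy₁ : y ≤ ρ₁) (hy₂ : y ≤ ρ₂) (hL : 0 ≤ L)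
    (hF : ∀ r ∈ Ioo x y, |f₁ (w₁ r) - f₂ (w₂ r)| ≤ L * |w₁ r - w₂ r| + δ) :
    (w₁ y - w₂ y) ^ 2 + (2 * (q₁ y - q₂ y) / y) ^ 2 ≤
      ((w₁ x - w₂ x) ^ 2 + (2 * (q₁ x - q₂ x) / x) ^ 2 + δ ^ 2) *
        Real.exp ((2 + L) * (y - x)) := by
  set E : ℝ → ℝ := fun r => (w₁ r - w₂ r) ^ 2 + (2 * (q₁ r - q₂ r) / r) ^ 2 + δ ^ 2 with hE
  set E' : ℝ → ℝ := fun r => 2 * (w₁ r - w₂ r) * (-(2 * (q₁ r - q₂ r) / r)) +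
    2 * (2 * (q₁ r - q₂ r) / r) *
      (f₁ (w₁ r) - f₂ (w₂ r) - (2 * (q₁ r - q₂ r) / r) / r) with hE'
  have hcE : ContinuousOn E (Icc x y) := by
    have hs₁ : Icc x y ⊆ Icc 0 ρ₁ := Icc_subset_Icc hx.le hy₁
    have hs₂ : Icc x y ⊆ Icc 0 ρ₂ := Icc_subset_Icc hx.le hy₂
    refine ((((h₁.cont_w.mono hs₁).sub (h₂.cont_w.mono hs₂)).pow 2).add
      (ContinuousOn.pow (ContinuousOn.div ?_ continuousOn_id fun r hr => ?_) 2)).add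
      continuousOn_const
    · exact continuousOn_const.mul ((h₁.cont_q.mono hs₁).sub (h₂.cont_q.mono hs₂))
    · exact (hx.trans_le hr.1).ne'
  have hdE : ∀ r ∈ Ioo x y, HasDerivAt E (E' r) r := by
    intro r hr
    have h0 : 0 < r := hx.trans hr.1
    have hr₁ : r ∈ Ioo 0 ρ₁ := ⟨h0, hr.2.trans_le hy₁⟩
    have hr₂ : r ∈ Ioo 0 ρ₂ := ⟨h0, hr.2.trans_le hy₂⟩
    have hd := ((h₁.deriv_w r hr₁).sub (h₂.deriv_w r hr₂)).pow 2
    have hp := ((((h₁.deriv_q r hr₁).sub (h₂.deriv_q r hr₂)).const_mul 2).div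
      (hasDerivAt_id r) h0.ne').pow 2
    refine ((hd.add hp).add_const (δ ^ 2)).congr_deriv ?_
    simp only [hE', Pi.sub_apply, Pi.div_apply, id, Nat.add_one_sub_one, pow_one, Nat.cast_ofNat]
    field_simp
    ring
  have hE'le : ∀ r ∈ Ioo x y, E' r ≤ (2 + L) * E r := by
    intro r hr
    have h0 : 0 < r := hx.trans hr.1
    have hFr := hF r hr
    simp only [hE, hE']
    generalize w₁ r - w₂ r = d at *
    generalize 2 * (q₁ r - q₂ r) / r = p at *
    generalize f₁ (w₁ r) - f₂ (w₂ r) = F at *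
    have h1 : 0 ≤ p * (p / r) := by rw [mul_div_assoc']; exact div_nonneg (mul_self_nonneg p) h0.le
    have h2 : p * F ≤ |p| * (L * |d| + δ) :=
      (le_abs_self _).trans (by rw [abs_mul]; gcongr)
    have h3 : -(d * p) ≤ |d| * |p| := (neg_le_abs _).trans (abs_mul _ _).le
    have h4 : L * (2 * (|d| * |p|)) ≤ L * (d ^ 2 + p ^ 2) := by
      gcongr
      rw [← sq_abs d, ← sq_abs p]
      nlinarith [sq_nonneg (|d| - |p|)]
    have h5 : 2 * (|d| * |p|) ≤ d ^ 2 + p ^ 2 := by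
      rw [← sq_abs d, ← sq_abs p]
      nlinarith [sq_nonneg (|d| - |p|)]
    have h6 : 2 * (|p| * δ) ≤ p ^ 2 + δ ^ 2 := by
      rw [← sq_abs p]
      nlinarith [sq_nonneg (|p| - δ)]
    nlinarith [sq_nonneg d, sq_nonneg δ, mul_nonneg hL (sq_nonneg δ)]
  have key := le_of_hasDerivAt_nonpos (f := fun r => E r * Real.exp (-(2 + L) * r))
    (f' := fun r => E' r * Real.exp (-(2 + L) * r) +
      E r * (Real.exp (-(2 + L) * r) * (-(2 + L)))) hxy ?_ ?_ ?_
  · have hexp : Real.exp (-(2 + L) * x) = Real.exp ((2 + L) * (y - x)) *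
        Real.exp (-(2 + L) * y) := by rw [← Real.exp_add]; ring_nf
    rw [hexp, ← mul_assoc] at key
    have := le_of_mul_le_mul_right key (Real.exp_pos _)
    refine le_trans ?_ this
    simp only [hE]
    linarith [sq_nonneg δ]
  · exact hcE.mul (by fun_prop)
  · intro r hr
    refine (hdE r hr).mul (HasDerivAt.exp ?_)
    simpa using (hasDerivAt_id r).const_mul (-(2 + L))
  · intro r hr
    have := mul_le_mul_of_nonneg_right (hE'le r hr) (Real.exp_pos (-(2 + L) * r)).le
    linarith

/-- Scaling the radius removes a multiplicative constant from the nonlinearity. -/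
lemma rescale {β : ℝ} (hβ : 0 < β) (h : RadialSystem (fun x => β * f x) 1 γ w q) :
    RadialSystem f √β γ (fun r => w (r / √β)) (fun r => q (r / √β)) := by
  have hs : 0 < √β := Real.sqrt_pos.2 hβ
  have hmaps : MapsTo (fun r => r / √β) (Icc 0 √β) (Icc 0 1) := fun r hr =>
    ⟨div_nonneg hr.1 hs.le, (div_le_one hs).2 hr.2⟩
  have hmapo : ∀ r ∈ Ioo 0 √β, r / √β ∈ Ioo (0 : ℝ) 1 := fun r hr =>
    ⟨div_pos hr.1 hs, (div_lt_one hs).2 hr.2⟩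
  have hd : ∀ r, HasDerivAt (fun r => r / √β) (1 / √β) r := fun r =>
    (hasDerivAt_id r).div_const _
  refine ⟨hs, h.cont_w.comp (by fun_prop) hmaps, h.cont_q.comp (by fun_prop) hmaps,
    fun r hr => ?_, fun r hr => ?_, by simpa using h.w_zero, by simpa using h.q_zero⟩
  · have := (h.deriv_w _ (hmapo r hr)).comp r (hd r)
    refine this.congr_deriv ?_
    have := hr.1.ne'
    field_simp
  · have := (h.deriv_q _ (hmapo r hr)).comp r (hd r)
    refine this.congr_deriv ?_
    have h2 := Real.sq_sqrt hβ.le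
    field_simp
    rw [h2]

end RadialSystem

lemma IsGSol.radialSystem {g : ℝ → ℝ} {β γ : ℝ} {u : ℝ → ℝ} (h : IsGSol g β γ u) :
    RadialSystem (fun x => β * (x * g x)) 1 γ u
      (fun r => -r * derivWithin u (Icc 0 1) r / 2) := by
  obtain ⟨hu, heq, -, -, h0⟩ := h
  have hv : ContDiffOn ℝ 1 (derivWithin u (Icc 0 1)) (Icc 0 1) :=
    hu.derivWithin (uniqueDiffOn_Icc one_pos) (by norm_cast)
  have hnhds : ∀ r ∈ Ioo (0 : ℝ) 1, Icc (0 : ℝ) 1 ∈ 𝓝 r := fun r hr => Icc_mem_nhds hr.1 hr.2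
  have hderiv : ∀ r ∈ Ioo (0 : ℝ) 1, derivWithin u (Icc 0 1) r = deriv u r := fun r hr =>
    derivWithin_of_mem_nhds (hnhds r hr)
  have hdv : ∀ r ∈ Ioo (0 : ℝ) 1,
      HasDerivAt (derivWithin u (Icc 0 1)) (deriv (deriv u) r) r := by
    intro r hr
    have h1 : DifferentiableAt ℝ (derivWithin u (Icc 0 1)) r :=
      (hv.differentiableOn (by norm_num)).differentiableAt (hnhds r hr)
    have h2 : derivWithin u (Icc 0 1) =ᶠ[𝓝 r] deriv u := by
      filter_upwards [Ioo_mem_nhds hr.1 hr.2] with t ht using hderiv t ht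
    rw [← h2.deriv_eq]
    exact h1.hasDerivAt
  refine ⟨one_pos, hu.continuousOn, ?_, fun r hr => ?_, fun r hr => ?_, h0, by simp⟩
  · exact (continuousOn_id.neg.mul hv.continuousOn).div_const 2
  · have h1 : DifferentiableAt ℝ u r :=
      (hu.differentiableOn (by simp)).differentiableAt (hnhds r hr)
    refine h1.hasDerivAt.congr_deriv ?_
    rw [hderiv r hr]
    have := hr.1.ne'
    field_simp
  · have h1 := ((hasDerivAt_id r).neg.mul (hdv r hr)).div_const 2
    refine h1.congr_deriv ?_
    have h2 := heq r hr
    simp only [radLap] at h2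
    simp only [Pi.neg_apply, id, hderiv r hr]
    have h3 : β * (u r * g (u r)) = -deriv (deriv u) r - deriv u r / r := by linarith
    rw [h3]
    have := hr.1.ne'
    field_simp
    ring

/-- The existence of a smooth solution with central value above `C` forces the nonlinearity to
be Lipschitz on `(0, C)`. -/
lemma IsGSol.exists_lipschitz {g : ℝ → ℝ} {β γ : ℝ} {u : ℝ → ℝ} (h : IsGSol g β γ u)
    (hβ : 0 < β) (hg : ∀ t, 0 ≤ t → 0 < g t) {C : ℝ} (hC : 0 < C) (hCγ : C < γ) :
    ∃ L, 0 ≤ L ∧ ∀ x ∈ Ioo 0 C, ∀ y ∈ Ioo 0 C, |x * g x - y * g y| ≤ L * |x - y| := by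
  have hsys := h.radialSystem
  obtain ⟨hu, heq, hpos, h1, h0⟩ := h
  have hfn : ∀ r ∈ Ioo (0 : ℝ) 1, 0 ≤ β * (u r * g (u r)) := fun r hr => by
    have h1 := hpos r ⟨hr.1.le, hr.2⟩
    have h2 := hg _ h1.le
    positivity
  obtain ⟨s, hs, hus⟩ : ∃ s ∈ Ioo (0 : ℝ) 1, u s = C := by
    have := intermediate_value_Ioo' zero_le_one hu.continuousOn
    rw [h0, h1] at this
    exact this ⟨hC, hCγ⟩
  set v := derivWithin u (Icc 0 1) with hv_def
  have hv : ContDiffOn ℝ 2 v (Icc 0 1) :=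
    hu.derivWithin (uniqueDiffOn_Icc one_pos) (by norm_cast)
  have hv' : ContDiffOn ℝ 1 (derivWithin v (Icc 0 1)) (Icc 0 1) :=
    hv.derivWithin (uniqueDiffOn_Icc one_pos) (by norm_num)
  have hsub : Icc s 1 ⊆ Icc 0 1 := Icc_subset_Icc hs.1.le le_rfl
  have hψ : ContDiffOn ℝ 1 (fun r => derivWithin v (Icc 0 1) r + v r / r) (Icc s 1) :=
    (hv'.mono hsub).add (((hv.of_le (by norm_num)).mono hsub).div contDiffOn_id
      fun r hr => (hs.1.trans_le hr.1).ne')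
  obtain ⟨K, hK⟩ := hψ.exists_lipschitzOnWith (by norm_num) (convex_Icc s 1) isCompact_Icc
  have hψeq : ∀ r ∈ Ioo s 1, derivWithin v (Icc 0 1) r + v r / r = -β * (u r * g (u r)) := by
    intro r hr
    have hr0 : r ∈ Ioo (0 : ℝ) 1 := ⟨hs.1.trans hr.1, hr.2⟩
    have hn : Icc (0 : ℝ) 1 ∈ 𝓝 r := Icc_mem_nhds hr0.1 hr0.2
    have h2 : v =ᶠ[𝓝 r] deriv u := by
      filter_upwards [Ioo_mem_nhds hr0.1 hr0.2] with t ht using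
        derivWithin_of_mem_nhds (Icc_mem_nhds ht.1 ht.2)
    rw [derivWithin_of_mem_nhds hn, h2.deriv_eq, h2.eq_of_nhds]
    have := heq r hr0
    simp only [radLap] at this
    linarith
  set m := 2 * (-s * v s / 2) with hm_def
  have hm : 0 < m := mul_pos two_pos
    (hsys.q_pos_of_lt hfn hs.1.le hs.2.le (hus.trans_lt hCγ))
  have hdist : ∀ r t, s < r → r ≤ t → t < 1 → m * (t - r) ≤ u r - u t := by
    intro r t hsr hrt ht
    have := le_of_hasDerivAt_nonpos (f := fun x => u x + m * x)
      (f' := fun x => -2 * (-x * v x / 2) / x + m * 1) hrt ?_ ?_ ?_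
    · linarith
    · exact (hu.continuousOn.mono (Icc_subset_Icc (hs.1.trans hsr).le ht.le)).add (by fun_prop)
    · intro x hx
      exact (hsys.deriv_w x ⟨(hs.1.trans hsr).trans hx.1, hx.2.trans ht⟩).add
        ((hasDerivAt_id x).const_mul m)
    · intro x hx
      have hx0 : 0 < x := (hs.1.trans hsr).trans hx.1
      have hx1 : x < 1 := hx.2.trans ht
      have hq := hsys.q_mono hfn hs.1.le (hsr.trans hx.1).le hx1.le
      have hmx : m * x ≤ m := mul_le_of_le_one_right hm.le hx1.le
      have : -2 * (-x * v x / 2) / x + m * 1 = (m * x - 2 * (-x * v x / 2)) / x := by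
        field_simp; ring
      rw [this]
      exact div_nonpos_of_nonpos_of_nonneg (by linarith) hx0.le
  have hpre : ∀ x ∈ Ioo 0 C, ∃ r ∈ Ioo s 1, u r = x := by
    intro x hx
    have := intermediate_value_Ioo' hs.2.le (hu.continuousOn.mono hsub)
    rw [h1, hus] at this
    exact this hx
  refine ⟨K / (β * m), by positivity, fun x hx y hy => ?_⟩
  obtain ⟨r, hr, rfl⟩ := hpre x hx
  obtain ⟨t, ht, rfl⟩ := hpre y hy
  have hlip := hK.dist_le_mul r (Ioo_subset_Icc_self hr) t (Ioo_subset_Icc_self ht)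
  rw [Real.dist_eq, Real.dist_eq, hψeq r hr, hψeq t ht, ← mul_sub, abs_mul, abs_neg,
    abs_of_pos hβ] at hlip
  have hrt : m * |r - t| ≤ |u r - u t| := by
    rcases le_total r t with hle | hle
    · rw [abs_sub_comm, abs_of_nonneg (sub_nonneg.2 hle)]
      exact (hdist r t hr.1 hle ht.2).trans (le_abs_self _)
    · rw [abs_of_nonneg (sub_nonneg.2 hle), abs_sub_comm (u r)]
      exact (hdist t r ht.1 hle hr.2).trans (le_abs_self _)
  rw [div_mul_eq_mul_div, le_div_iff₀ (by positivity)]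
  have hK0 : (0 : ℝ) ≤ K := K.2
  calc |u r * g (u r) - u t * g (u t)| * (β * m)
      = (β * |u r * g (u r) - u t * g (u t)|) * m := by ring
    _ ≤ K * |r - t| * m := by gcongr
    _ = K * (m * |r - t|) := by ring
    _ ≤ K * |u r - u t| := by gcongr

namespace IsCritical

variable {a c₀ : ℝ} {f : ℝ → ℝ}

lemma comp_nonneg (hf : IsCritical a c₀ f) {R : ℝ} {w : ℝ → ℝ}
    (hpos : ∀ r ∈ Ico 0 R, 0 < w r) : ∀ r ∈ Ioo 0 R, 0 ≤ f (w r) :=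
  fun r hr => hf.nonneg _ (hpos r ⟨hr.1.le, hr.2⟩).le

/-- Away from the origin, large solutions are uniformly close to the solution with central
value `a / 2`, as far as both are defined. -/
lemma eventually_dist_le (hf : IsCritical a c₀ f) {L : ℝ} (hL0 : 0 ≤ L)
    (hL : ∀ x ∈ Ioo 0 (a / 2 + 1), ∀ y ∈ Ioo 0 (a / 2 + 1), |f x - f y| ≤ L * |x - y|)
    {M : ℝ} (hM : ∀ x ∈ Icc 0 (a / 2), f x ≤ M) {Rh : ℝ} {wh qh : ℝ → ℝ}
    (hh : RadialSystem f Rh (a / 2) wh qh) (hhpos : ∀ r ∈ Ico 0 Rh, 0 < wh r)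
    {ε : ℝ} (hε : 0 < ε) :
    ∀ᶠ γ in atTop, ∀ R w q, RadialSystem f R γ w q → (∀ r ∈ Ico 0 R, 0 < w r) → w R = 0 →
      ∀ r, γ ^ (-(3 / 4) : ℝ) ≤ r → r ≤ R → r ≤ Rh →
        |w r - wh r| < ε ∧ |2 * (q r - qh r) / r| < ε := by
  have ha := hf.a_pos
  have hhn := hf.comp_nonneg hhpos
  set δ := min 1 (ε / 5 * Real.exp (-((2 + L) * Rh))) with hδ_def
  have hδ : 0 < δ := by positivity
  obtain ⟨η, hη, hηR, hnear⟩ := hh.eventually_near_zero hhn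
    (fun r hr => hM _ ⟨(hhpos r ⟨hr.1.le, hr.2⟩).le, hh.w_le hhn hr.1.le hr.2.le⟩) hδ
  filter_upwards [hf.matching hδ, tendsto_matching_radius.eventually (gt_mem_nhds hη),
    eventually_gt_atTop 0] with γ hmatch hρη hγ R w q h hpos hend r hρr hrR hrRh
  have hρ0 : 0 < γ ^ (-(3 / 4) : ℝ) := Real.rpow_pos_of_pos hγ _
  obtain ⟨hρR, hw, hq⟩ := hmatch R w q h hpos hend
  generalize γ ^ (-(3 / 4) : ℝ) = ρ at *
  obtain ⟨hwh, hqh⟩ := hnear ρ hρ0 hρη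
  have hn := hf.comp_nonneg hpos
  have hδ1 : δ ≤ 1 := min_le_left _ _
  have hgr := h.dist_le hh (δ := 0) hρ0 hρr hrR hrRh hL0 fun t ht => by
    rw [add_zero]
    have ht0 : 0 < t := hρ0.trans ht.1
    refine hL _ ⟨hpos t ⟨ht0.le, ht.2.trans_le hrR⟩, ?_⟩ _
      ⟨hhpos t ⟨ht0.le, ht.2.trans_le hrRh⟩, ?_⟩
    · have := h.w_anti hn hρ0.le ht.1.le (ht.2.le.trans hrR)
      linarith [(abs_lt.1 hw).2]
    · linarith [hh.w_le hhn ht0.le (ht.2.le.trans hrRh)]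
  have hw2 : |w ρ - wh ρ| < 2 * δ := by
    rw [abs_lt] at *
    constructor <;> linarith
  have hq2 : |2 * (q ρ - qh ρ) / ρ| < 4 * δ := by
    have : 2 * (q ρ - qh ρ) / ρ = 2 * (q ρ / ρ) - 2 * (qh ρ / ρ) := by ring
    rw [this, abs_lt]
    rw [abs_lt] at hq hqh
    constructor <;> linarith
  have hexp : Real.exp ((2 + L) * (r - ρ)) ≤ Real.exp ((2 + L) * Rh) := by
    gcongr
    linarith
  have hδε : δ * Real.exp ((2 + L) * Rh) ≤ ε / 5 := by
    have : δ ≤ ε / 5 * Real.exp (-((2 + L) * Rh)) := min_le_right _ _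
    rw [Real.exp_neg, ← div_eq_mul_inv] at this
    exact (le_div_iff₀ (Real.exp_pos _)).1 this
  have hδε' : δ ≤ ε / 5 := by
    refine le_trans (le_mul_of_one_le_right hδ.le (Real.one_le_exp ?_)) hδε
    have := hh.pos
    positivity
  have hfin : (w r - wh r) ^ 2 + (2 * (q r - qh r) / r) ^ 2 < ε ^ 2 := by
    calc _ ≤ _ := hgr
      _ ≤ ((2 * δ) ^ 2 + (4 * δ) ^ 2 + 0 ^ 2) * Real.exp ((2 + L) * Rh) := by
        have h1 := sq_lt_sq' (by linarith [abs_lt.1 hw2]) (abs_lt.1 hw2).2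
        have h2 := sq_lt_sq' (by linarith [abs_lt.1 hq2]) (abs_lt.1 hq2).2
        gcongr
      _ = 20 * δ * (δ * Real.exp ((2 + L) * Rh)) := by ring
      _ ≤ 20 * (ε / 5) * (ε / 5) := by gcongr
      _ < ε ^ 2 := by nlinarith
  constructor <;> refine abs_lt_of_sq_lt_sq (lt_of_le_of_lt ?_ hfin) hε.le
  · linarith [sq_nonneg (2 * (q r - qh r) / r)]
  · linarith [sq_nonneg (w r - wh r)]

/-- The first zero of large solutions converges to the first zero of the solution with central
value `a / 2`. -/
lemma eventually_radius (hf : IsCritical a c₀ f) {L : ℝ} (hL0 : 0 ≤ L)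
    (hL : ∀ x ∈ Ioo 0 (a / 2 + 1), ∀ y ∈ Ioo 0 (a / 2 + 1), |f x - f y| ≤ L * |x - y|)
    {M : ℝ} (hM : ∀ x ∈ Icc 0 (a / 2), f x ≤ M) {Rh : ℝ} {wh qh : ℝ → ℝ}
    (hh : RadialSystem f Rh (a / 2) wh qh) (hhpos : ∀ r ∈ Ico 0 Rh, 0 < wh r) (hhend : wh Rh = 0)
    {η : ℝ} (hη : 0 < η) :
    ∀ᶠ γ in atTop, ∀ R w q, RadialSystem f R γ w q → (∀ r ∈ Ico 0 R, 0 < w r) → w R = 0 →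
      |R - Rh| < η := by
  have ha := hf.a_pos
  have hRh := hh.pos
  have hhn := hf.comp_nonneg hhpos
  have hq0 : 0 < qh Rh := hh.q_pos_of_lt hhn hRh.le le_rfl (by rw [hhend]; linarith)
  set t := max (Rh / 2) (Rh - η / 2) with ht_def
  have ht0 : 0 < t := (half_pos hRh).trans_le (le_max_left _ _)
  have htR : t < Rh := max_lt (by linarith) (by linarith)
  have htη : Rh - η / 2 ≤ t := le_max_right _ _
  have hlog : 0 < Real.log (Rh + η) - Real.log Rh :=
    sub_pos.2 (Real.log_lt_log hRh (by linarith))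
  have hwt := hhpos t ⟨ht0.le, htR⟩
  set ε := min (min (wh t) (qh Rh / Rh))
    (qh Rh * (Real.log (Rh + η) - Real.log Rh)) with hε_def
  have hε : 0 < ε := by positivity
  have hε1 : ε ≤ wh t := (min_le_left _ _).trans (min_le_left _ _)
  have hε2 : ε ≤ qh Rh / Rh := (min_le_left _ _).trans (min_le_right _ _)
  have hε3 : ε ≤ qh Rh * (Real.log (Rh + η) - Real.log Rh) := min_le_right _ _
  filter_upwards [hf.eventually_dist_le hL0 hL hM hh hhpos hε, hf.matching one_pos,
    tendsto_matching_radius.eventually (gt_mem_nhds hRh), eventually_gt_atTop 0]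
    with γ hd hmatch hρRh hγ R w q h hpos hend
  have hρR := (hmatch R w q h hpos hend).1
  have hρ0 : 0 < γ ^ (-(3 / 4) : ℝ) := Real.rpow_pos_of_pos hγ _
  have hn := hf.comp_nonneg hpos
  rcases le_or_gt R Rh with hle | hlt
  · have h1 := (hd R w q h hpos hend R hρR.le le_rfl hle).1
    rw [hend, zero_sub, abs_neg] at h1
    have htR' : t < R := by
      by_contra! hRt
      have h2 := hh.w_anti hhn h.pos.le hRt htR.le
      linarith [le_abs_self (wh R)]
    rw [abs_lt]
    constructor <;> linarith
  · obtain ⟨h1, h2⟩ := hd R w q h hpos hend Rh hρRh.le hlt.le le_rfl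
    rw [hhend, sub_zero] at h1
    have hq : qh Rh / 2 ≤ q Rh := by
      have h3 := (abs_lt.1 (h2.trans_le hε2)).1
      have h4 : -qh Rh < 2 * (q Rh - qh Rh) := by
        rw [← neg_div] at h3
        exact (div_lt_div_iff_of_pos_right hRh).1 h3
      linarith
    have h5 := h.w_le_of_le_q hRh hlt.le le_rfl (Q := qh Rh / 2) fun r hr =>
      hq.trans (h.q_mono hn hRh.le hr.1.le hr.2.le)
    rw [hend] at h5
    have h6 : qh Rh * (Real.log R - Real.log Rh) <
        qh Rh * (Real.log (Rh + η) - Real.log Rh) := by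
      linarith [le_abs_self (w Rh)]
    have h7 : R < Rh + η :=
      (Real.log_lt_log_iff h.pos (by linarith)).1 (by linarith [lt_of_mul_lt_mul_left h6 hq0.le])
    rw [abs_of_pos (sub_pos.2 hlt)]
    linarith

end IsCritical

/-- Uniform convergence, away from the origin, of solutions on the unit disk and of their
derivatives, given the convergence of the multipliers. -/
lemma IsCritical.eventually_dist_lt {a c₀ : ℝ} {f : ℝ → ℝ} (hf : IsCritical a c₀ f)
    {L : ℝ} (hL0 : 0 ≤ L)
    (hL : ∀ x ∈ Ioo 0 (a / 2 + 1), ∀ y ∈ Ioo 0 (a / 2 + 1), |f x - f y| ≤ L * |x - y|)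
    {M : ℝ} (hM : ∀ x ∈ Icc 0 (a / 2), f x ≤ M) {β : ℝ → ℝ} {βh : ℝ} {w q : ℝ → ℝ → ℝ}
    {wh qh : ℝ → ℝ} (hβ : ∀ γ, 0 < γ → 0 < β γ) (hβh : 0 < βh) (hlim : Tendsto β atTop (𝓝 βh))
    (h : ∀ γ, 0 < γ → RadialSystem (fun x => β γ * f x) 1 γ (w γ) (q γ))
    (hpos : ∀ γ, 0 < γ → ∀ r ∈ Ico (0 : ℝ) 1, 0 < w γ r) (hend : ∀ γ, 0 < γ → w γ 1 = 0)
    (hh : RadialSystem (fun x => βh * f x) 1 (a / 2) wh qh)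
    (hhpos : ∀ r ∈ Ico (0 : ℝ) 1, 0 < wh r) {s ε : ℝ} (hs : 0 < s) (hε : 0 < ε) :
    ∀ᶠ γ in atTop, ∀ r ∈ Icc s 1,
      |w γ r - wh r| < ε ∧ |2 * (q γ r - qh r) / r| < ε := by
  have ha := hf.a_pos
  have hM0 : 0 ≤ M := (hf.nonneg 0 le_rfl).trans (hM 0 ⟨le_rfl, by linarith⟩)
  have hhn : ∀ r ∈ Ioo (0 : ℝ) 1, 0 ≤ βh * f (wh r) := fun r hr =>
    mul_nonneg hβh.le (hf.comp_nonneg hhpos r hr)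
  have hwhM : ∀ r ∈ Ioo (0 : ℝ) 1, f (wh r) ≤ M := fun r hr =>
    hM _ ⟨(hhpos r ⟨hr.1.le, hr.2⟩).le, hh.w_le hhn hr.1.le hr.2.le⟩
  set K := 2 + 2 * βh * L with hK_def
  set B := √(2 * βh) with hB_def
  have hB0 : 0 ≤ B := Real.sqrt_nonneg _
  set A := 9 + 4 * (B + 1) ^ 2 with hA_def
  have hA : 0 < A := by positivity
  obtain ⟨δ, hδ0, hδ1, hδε⟩ : ∃ δ > 0, δ ≤ 1 ∧ A * δ ^ 2 * Real.exp K < ε ^ 2 := by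
    have hc : Tendsto (fun δ : ℝ => A * δ ^ 2 * Real.exp K) (𝓝[>] 0) (𝓝 0) := by
      have : Continuous fun δ : ℝ => A * δ ^ 2 * Real.exp K := by fun_prop
      simpa using (this.tendsto 0).mono_left nhdsWithin_le_nhds
    obtain ⟨δ, h1, h2, h3⟩ := ((hc.eventually (gt_mem_nhds (by positivity : 0 < ε ^ 2))).and
      (Ioc_mem_nhdsGT one_pos)).exists
    exact ⟨δ, h2, h3, h1⟩
  obtain ⟨η, hη, hη1, hnear⟩ := hh.eventually_near_zero hhn (M := βh * M)
    (fun r hr => mul_le_mul_of_nonneg_left (hwhM r hr) hβh.le) hδ0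
  have hβs : 0 < √(βh / 2) := Real.sqrt_pos.2 (by linarith)
  have hβδ : ∀ᶠ γ in atTop, |β γ - βh| * M < 2 * δ := by
    have h1 : Tendsto (fun γ => |β γ - βh| * M) atTop (𝓝 (|βh - βh| * M)) :=
      (hlim.sub_const βh).abs.mul_const M
    rw [sub_self, abs_zero, zero_mul] at h1
    exact h1.eventually (gt_mem_nhds (by positivity))
  filter_upwards [hf.matching hδ0, eventually_gt_atTop 0, hβδ,
    hlim.eventually (lt_mem_nhds (by linarith : βh / 2 < βh)),
    hlim.eventually (gt_mem_nhds (by linarith : βh < 2 * βh)),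
    tendsto_matching_radius.eventually (gt_mem_nhds (mul_pos hη hβs)),
    tendsto_matching_radius.eventually (gt_mem_nhds (mul_pos hs hβs))]
    with γ hmatch hγ hβM hβ1 hβ2 hρη hρs r hr
  have hρ0 : 0 < γ ^ (-(3 / 4) : ℝ) := Real.rpow_pos_of_pos hγ _
  have hβγ := hβ γ hγ
  have hR : 0 < √(β γ) := Real.sqrt_pos.2 hβγ
  have hm := hmatch _ _ _ ((h γ hγ).rescale hβγ)
    (fun t ht => hpos γ hγ _ ⟨div_nonneg ht.1 hR.le, (div_lt_one hR).2 ht.2⟩)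
    (by rw [div_self hR.ne', hend γ hγ])
  generalize γ ^ (-(3 / 4) : ℝ) = ρ at *
  obtain ⟨hρR, hw, hq⟩ := hm
  have hRlow : √(βh / 2) ≤ √(β γ) := Real.sqrt_le_sqrt hβ1.le
  have hRB : √(β γ) ≤ B := Real.sqrt_le_sqrt hβ2.le
  set x := ρ / √(β γ) with hx_def
  have hx0 : 0 < x := div_pos hρ0 hR
  have hxη : x < η := (div_lt_iff₀ hR).2 (hρη.trans_le (by gcongr))
  have hxs : x < s := (div_lt_iff₀ hR).2 (hρs.trans_le (by gcongr))
  have hxr : x ≤ r := hxs.le.trans hr.1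
  obtain ⟨hwh, hqh⟩ := hnear x hx0 hxη
  have hn : ∀ r ∈ Ioo (0 : ℝ) 1, 0 ≤ β γ * f (w γ r) := fun r hr =>
    mul_nonneg hβγ.le (hf.comp_nonneg (hpos γ hγ) r hr)
  have hgr := (h γ hγ).dist_le hh (L := 2 * βh * L) (δ := 2 * δ) hx0 hxr hr.2 hr.2
    (by positivity) fun t ht => by
    have ht0 : 0 < t := hx0.trans ht.1
    have ht1 : t < 1 := ht.2.trans_le hr.2
    have hlip := hL (w γ t) ⟨hpos γ hγ t ⟨ht0.le, ht1⟩, by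
      have := (h γ hγ).w_anti hn hx0.le ht.1.le ht1.le
      linarith [(abs_lt.1 hw).2]⟩ (wh t) ⟨hhpos t ⟨ht0.le, ht1⟩, by
      linarith [hh.w_le hhn ht0.le ht1.le]⟩
    have hfM : |f (wh t)| ≤ M := by
      rw [abs_of_nonneg (hf.comp_nonneg hhpos t ⟨ht0, ht1⟩)]
      exact hwhM t ⟨ht0, ht1⟩
    calc |β γ * f (w γ t) - βh * f (wh t)|
        = |β γ * (f (w γ t) - f (wh t)) + (β γ - βh) * f (wh t)| := by ring_nf
      _ ≤ |β γ| * |f (w γ t) - f (wh t)| + |β γ - βh| * |f (wh t)| := by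
        rw [← abs_mul, ← abs_mul]; exact abs_add_le _ _
      _ ≤ 2 * βh * (L * |w γ t - wh t|) + |β γ - βh| * M := by
        rw [abs_of_pos hβγ]
        gcongr
      _ ≤ 2 * βh * L * |w γ t - wh t| + 2 * δ := by linarith
  have hw2 : |w γ x - wh x| < 2 * δ := by
    rw [abs_lt] at *
    constructor <;> linarith
  have hqx : |q γ x / x| < B * δ := by
    have : q γ x / x = √(β γ) * (q γ x / ρ) := by
      rw [hx_def]
      field_simp
    rw [this, abs_mul, abs_of_pos hR]
    calc _ < √(β γ) * δ := by gcongr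
      _ ≤ B * δ := by gcongr
  have hq2 : |2 * (q γ x - qh x) / x| < 2 * (B + 1) * δ := by
    have : 2 * (q γ x - qh x) / x = 2 * (q γ x / x) - 2 * (qh x / x) := by ring
    rw [this, abs_lt]
    rw [abs_lt] at hqx hqh
    constructor <;> linarith
  have hfin : (w γ r - wh r) ^ 2 + (2 * (q γ r - qh r) / r) ^ 2 < ε ^ 2 := by
    calc _ ≤ _ := hgr
      _ ≤ ((2 * δ) ^ 2 + (2 * (B + 1) * δ) ^ 2 + (2 * δ) ^ 2) * Real.exp K := by
        have h1 := sq_lt_sq' (by linarith [abs_lt.1 hw2]) (abs_lt.1 hw2).2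
        have h2 := sq_lt_sq' (by linarith [abs_lt.1 hq2]) (abs_lt.1 hq2).2
        have h3 : (2 + 2 * βh * L) * (r - x) ≤ K :=
          mul_le_of_le_one_right (by positivity) (by linarith [hr.2])
        gcongr
      _ ≤ A * δ ^ 2 * Real.exp K := by
        gcongr
        nlinarith [sq_nonneg δ]
      _ < ε ^ 2 := hδε
  constructor <;> refine abs_lt_of_sq_lt_sq (lt_of_le_of_lt ?_ hfin) hε.le
  · linarith [sq_nonneg (2 * (q γ r - qh r) / r)]
  · linarith [sq_nonneg (w γ r - wh r)]

/-- As γ → +∞, β_γ → β_{a/2} and u_γ → u_{a/2} in C¹_loc(Ω̄∖{0}),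
where (β_{a/2}, u_{a/2}) is the unique pair with β_{a/2} > 0 and u_{a/2} the smooth
positive radial solution of Δu = β_{a/2} u g(u) with u(0) = a/2. Radially, C¹_loc
convergence on Ω̄∖{0} means uniform convergence of u_γ and of its derivative on every
annulus [s,1], 0 < s < 1. -/
theorem statement17 (a c0 : ℝ) (g : ℝ → ℝ) (hG : GCtx a c0 g)
    (β : ℝ → ℝ) (u : ℝ → ℝ → ℝ)
    (hsol : ∀ γ : ℝ, 0 < γ → 0 < β γ ∧ IsGSol g (β γ) γ (u γ))
    (βh : ℝ) (uh : ℝ → ℝ) (hh : 0 < βh ∧ IsGSol g βh (a / 2) uh) :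
    Tendsto β atTop (𝓝 βh) ∧
    ∀ s ∈ Set.Ioo (0:ℝ) 1,
      TendstoUniformlyOn (fun (γ : ℝ) (r : ℝ) => u γ r) uh atTop (Set.Icc s 1) ∧
      TendstoUniformlyOn (fun (γ : ℝ) (r : ℝ) => derivWithin (u γ) (Set.Icc 0 1) r)
        (derivWithin uh (Set.Icc 0 1)) atTop (Set.Icc s 1) := by
  obtain ⟨ha, hc, hgc, hg, hge⟩ := hG
  obtain ⟨hβh, hsolh⟩ := hh
  set f : ℝ → ℝ := fun x => x * g x with hf_def
  have hf : IsCritical a c0 f :=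
    ⟨ha, continuousOn_id.mul hgc, fun x hx => mul_nonneg hx (hg x hx).le, fun x hx => by
      simp only [hf_def, expNonlin, hge x hx]⟩
  obtain ⟨hβ2, hsol2⟩ := hsol (a / 2 + 2) (by linarith)
  obtain ⟨L, hL0, hL⟩ := hsol2.exists_lipschitz hβ2 hg (C := a / 2 + 1) (by linarith)
    (by linarith)
  obtain ⟨M, hM⟩ := isCompact_Icc.bddAbove_image
    (hf.cont.mono (Icc_subset_Ici_self : Icc 0 (a / 2) ⊆ Ici 0))
  have hfM : ∀ x ∈ Icc 0 (a / 2), f x ≤ M := fun x hx => hM (mem_image_of_mem f hx)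
  have hrescale : ∀ {b γ : ℝ} {v : ℝ → ℝ}, 0 < b → IsGSol g b γ v →
      (∀ r ∈ Ico 0 √b, 0 < v (r / √b)) ∧ v (√b / √b) = 0 := by
    intro b γ v hb hv
    have hR : 0 < √b := Real.sqrt_pos.2 hb
    exact ⟨fun r hr => hv.2.2.1 _ ⟨div_nonneg hr.1 hR.le, (div_lt_one hR).2 hr.2⟩,
      by rw [div_self hR.ne']; exact hv.2.2.2.1⟩
  have hβlim : Tendsto β atTop (𝓝 βh) := by
    have hsqrt : Tendsto (fun γ => √(β γ)) atTop (𝓝 √βh) := by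
      rw [Metric.tendsto_atTop']
      intro η hη
      obtain ⟨N, hN⟩ := eventually_atTop.1 ((hf.eventually_radius hL0 hL hfM
        (RadialSystem.rescale hβh hsolh.radialSystem) (hrescale hβh hsolh).1
        (hrescale hβh hsolh).2 hη).and (eventually_gt_atTop 0))
      refine ⟨N, fun γ hγ => ?_⟩
      obtain ⟨h1, h2⟩ := hN γ hγ.le
      obtain ⟨h3, h4⟩ := hsol γ h2
      exact h1 _ _ _ (RadialSystem.rescale h3 h4.radialSystem) (hrescale h3 h4).1
        (hrescale h3 h4).2
    have hsq := hsqrt.pow 2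
    rw [Real.sq_sqrt hβh.le] at hsq
    refine hsq.congr' ?_
    filter_upwards [eventually_gt_atTop 0] with γ hγ using Real.sq_sqrt (hsol γ hγ).1.le
  refine ⟨hβlim, fun s hs => ?_⟩
  have key : ∀ ε : ℝ, 0 < ε → _ := fun ε hε => hf.eventually_dist_lt hL0 hL hfM (s := s) (ε := ε)
    (fun γ hγ => (hsol γ hγ).1) hβh hβlim (fun γ hγ => (hsol γ hγ).2.radialSystem)
    (fun γ hγ => (hsol γ hγ).2.2.2.1) (fun γ hγ => (hsol γ hγ).2.2.2.2.1)
    hsolh.radialSystem hsolh.2.2.1 hs.1 hε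
  constructor
  · rw [Metric.tendstoUniformlyOn_iff]
    intro ε hε
    filter_upwards [key ε hε] with γ hγ r hr
    rw [dist_comm]
    exact (hγ r hr).1
  · rw [Metric.tendstoUniformlyOn_iff]
    intro ε hε
    filter_upwards [key ε hε] with γ hγ r hr
    have hr0 : r ≠ 0 := (hs.1.trans_le hr.1).ne'
    have := (hγ r hr).2
    rw [Real.dist_eq]
    convert this using 2
    field_simp
    ring

end
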